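/- arXiv:math/0502398 — 3 statements merged into one kernel-verified Lean document; each statement's English description precedes it below -/
import Mathlib

section
/- Let X, X₀ : ℝ^N → ℝ^N be smooth vector fields such that X₀(0) = 0, the difference X₁ := X − X₀ vanishes to infinite order at 0, and outside some compact set both X and X₀ coincide with the linear vector field z ↦ Az, where A = DX(0) is the linearization of X at 0 and has no purely imaginary complex eigenvalue. Let U and U₀ be the (complete) flows of X and X₀, and let E ⊆ ℝ^N be a linear subspace with X₀(x) ∈ E for all x ∈ E, such that U₀(t)x → 0 as t → +∞ for every x ∈ E. Then: (1) for every x ∈ E the limit W₋x := lim_{t→+∞} U(−t)(U₀(t)x) exists; (2) W₋ : E → ℝ^N is continuous; and (3) for every m ∈ ℕ there is a constant C > 0 such that ‖W₋x − x‖ ≤ C‖x‖^m for all x ∈ E with ‖x‖ ≤ 1. -/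
open Filter

section spectral
variable {E : Type*} [NormedAddCommGroup E] [NormedSpace ℝ E] [FiniteDimensional ℝ E]

lemma nwo_comp_exp (B : E →L[ℝ] E) (l : E →L[ℝ] ℂ) (μ : ℂ) (h : ∀ x, l (B x) = μ * l x) (x : E) :
    l ((NormedSpace.exp B) x) = Complex.exp μ * l x := by
  have : CompleteSpace E := FiniteDimensional.complete ℝ E
  have h1 := NormedSpace.exp_series_hasSum_exp' (𝕂 := ℝ) B
  have h2 := (h1.mapL (ContinuousLinearMap.apply ℝ E x)).mapL l
  have h3 := (NormedSpace.exp_series_hasSum_exp' (𝕂 := ℝ) μ).mul_right (l x)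
  have hp : ∀ n : ℕ, l ((B ^ n) x) = μ ^ n * l x := by
    intro n
    induction n with
    | zero => simp
    | succ n ih => rw [pow_succ', mul_apply_eq_comp, h, ih]; ring
  rw [Complex.exp_eq_exp_ℂ]
  refine h2.unique ?_
  have h4 : (fun b : ℕ => l (((ContinuousLinearMap.apply ℝ E) x) ((b.factorial : ℝ)⁻¹ • B ^ b)))
      = fun i : ℕ => (i.factorial : ℝ)⁻¹ • μ ^ i * l x := by
    funext n
    change l (((n.factorial : ℝ)⁻¹ • B ^ n) x) = _
    rw [smul_apply, map_smul, hp, smul_mul_assoc]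
  rw [h4]
  exact h3

lemma nwo_spectral (B : E →L[ℝ] E)
    (hB : ∀ (μ : ℂ) (l : E →L[ℝ] ℂ), l ≠ 0 → (∀ x, l (B x) = μ * l x) → μ.re < 0) :
    ∃ n : ℕ, 0 < n ∧ ‖(NormedSpace.exp B) ^ n‖ ≤ 1 / 4 := by
  have : CompleteSpace E := FiniteDimensional.complete ℝ E
  rcases subsingleton_or_nontrivial E with hE | hE
  · exact ⟨1, one_pos, by
      have : (NormedSpace.exp B) ^ 1 = 0 := by ext x; exact Subsingleton.elim _ _
      rw [this]; norm_num⟩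
  let V := E →L[ℝ] ℂ
  have : FiniteDimensional ℝ V := inferInstance
  have : FiniteDimensional ℂ V := Module.Finite.of_restrictScalars_finite ℝ ℂ V
  have : CompleteSpace V := inferInstance
  have : Nontrivial V := by
    obtain ⟨x, hx⟩ := exists_ne (0 : E)
    obtain ⟨g, -, hg⟩ := exists_dual_vector ℝ x (norm_ne_zero_iff.2 hx)
    refine ⟨⟨Complex.ofRealCLM.comp g, 0, fun h => ?_⟩⟩
    have := congrArg (fun f : V => f x) h
    change ((g x : ℝ) : ℂ) = 0 at this
    rw [hg] at this
    exact hx (by simpa using this)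
  let R := NormedSpace.exp B
  let st : (E →L[ℝ] E) → (V →L[ℂ] V) := fun T =>
    LinearMap.toContinuousLinearMap
      { toFun := fun l => l.comp T
        map_add' := fun _ _ => rfl
        map_smul' := fun _ _ => rfl }
  let Rs : V →L[ℂ] V := st R
  let Bs : V →L[ℂ] V := st B
  have hRs : ∀ l x, Rs l x = l (R x) := fun l x => rfl
  have hBs : ∀ l x, Bs l x = l (B x) := fun l x => rfl
  have hcomm : R * B = B * R := ((Commute.refl B).exp_left).eq
  have hspec : ∀ z ∈ spectrum ℂ Rs, ‖z‖₊ < 1 := by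
    intro z hz
    have hz' : z ∈ spectrum ℂ (Rs : V →ₗ[ℂ] V) := by
      rw [spectrum.mem_iff] at hz ⊢
      intro hu
      apply hz
      rw [ContinuousLinearMap.isUnit_iff_bijective]
      rw [Module.End.isUnit_iff] at hu
      exact hu
    have hev : Module.End.HasEigenvalue (Rs : V →ₗ[ℂ] V) z :=
      Module.End.hasEigenvalue_iff_mem_spectrum.2 hz'
    let S := Module.End.eigenspace (Rs : V →ₗ[ℂ] V) z
    have hS : ∀ l ∈ S, (Bs : V →ₗ[ℂ] V) l ∈ S := by
      intro l hl
      rw [Module.End.mem_eigenspace_iff] at hl ⊢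
      ext x
      have h1 : l (R (B x)) = z * l (B x) := by
        have := congrArg (fun f : V => f (B x)) hl
        simpa [hRs] using this
      have h2 : B (R x) = R (B x) := by
        have := congrArg (fun f : E →L[ℝ] E => f x) hcomm
        simpa using this.symm
      change l (B (R x)) = z * l (B x)
      rw [h2, h1]
    have : Nontrivial S := by
      rw [Submodule.nontrivial_iff_ne_bot]; exact hev
    obtain ⟨μ, hμ⟩ := Module.End.exists_eigenvalue (K := ℂ) (V := S) ((Bs : V →ₗ[ℂ] V).restrict hS)
    obtain ⟨l, hl⟩ := hμ.exists_hasEigenvector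
    have hl1 := hl.apply_eq_smul
    have hl0 : (l : V) ≠ 0 := fun h => hl.2 (Subtype.ext h)
    have hl2 : ∀ x, (l : V) (B x) = μ * (l : V) x := by
      intro x
      have := congrArg (fun f : S => (f : V) x) hl1
      simpa [LinearMap.restrict_apply, hBs] using this
    have hre := hB μ l hl0 hl2
    obtain ⟨x, hx⟩ : ∃ x, (l : V) x ≠ 0 := by
      by_contra! h
      exact hl0 (ContinuousLinearMap.ext h)
    have h3 : (l : V) (R x) = z * (l : V) x := by
      have := congrArg (fun f : V => f x) (Module.End.mem_eigenspace_iff.1 l.2)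
      simpa [hRs] using this
    have h4 := nwo_comp_exp B l μ hl2 x
    have h5 : z = Complex.exp μ := mul_right_cancel₀ hx (h3.symm.trans h4)
    rw [← NNReal.coe_lt_coe]
    simp [h5, Complex.norm_exp, hre]
  have hrad : spectralRadius ℂ Rs < (1 : NNReal) := spectrum.spectralRadius_lt_of_forall_lt Rs hspec
  obtain ⟨r, hr1, hr2⟩ := ENNReal.lt_iff_exists_nnreal_btwn.1 hrad
  have hr2' : (r : ℝ) < 1 := by exact_mod_cast hr2
  have hg := spectrum.pow_nnnorm_pow_one_div_tendsto_nhds_spectralRadius Rs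
  have hg2 := hg.eventually (gt_mem_nhds hr1)
  have hr3 : ∀ᶠ n : ℕ in atTop, (r : ℝ) ^ n < 1 / 4 :=
    (tendsto_pow_atTop_nhds_zero_of_lt_one r.2 hr2').eventually (gt_mem_nhds (by norm_num))
  obtain ⟨n, ⟨hn1, hn2⟩, hn3⟩ := ((hg2.and hr3).and (eventually_gt_atTop 0)).exists
  have hn4 : ‖Rs ^ n‖ ≤ 1 / 4 := by
    refine le_trans ?_ hn2.le
    have h1 : (‖Rs ^ n‖₊ : ENNReal) ≤ (r : ENNReal) ^ n := by
      have := ENNReal.rpow_le_rpow hn1.le (Nat.cast_nonneg (α := ℝ) n)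
      rw [← ENNReal.rpow_mul, one_div, inv_mul_cancel₀ (by positivity), ENNReal.rpow_one,
        ENNReal.rpow_natCast] at this
      exact this
    have h2 : ‖Rs ^ n‖₊ ≤ r ^ n := by exact_mod_cast h1
    exact_mod_cast h2
  have hpow : ∀ (n : ℕ) (l : V) x, (Rs ^ n) l x = l ((R ^ n) x) := by
    intro n
    induction n with
    | zero => intros; simp
    | succ n ih =>
      intro l x
      rw [pow_succ, mul_apply_eq_comp, ih, hRs, pow_succ', mul_apply_eq_comp]
  refine ⟨n, hn3, ContinuousLinearMap.opNorm_le_bound _ (by norm_num) fun x => ?_⟩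
  obtain ⟨g, hg1, hg2⟩ := exists_dual_vector'' ℝ ((R ^ n) x)
  let l : V := Complex.ofRealCLM.comp g
  have hl : ‖l‖ ≤ 1 := by
    refine ContinuousLinearMap.opNorm_le_bound _ (by norm_num) fun y => ?_
    simp only [l, ContinuousLinearMap.comp_apply, Complex.ofRealCLM_apply, Complex.norm_real]
    exact g.le_of_opNorm_le hg1 y
  have h1 : ‖(Rs ^ n) l x‖ = ‖(R ^ n) x‖ := by
    rw [hpow]
    change ‖((g ((R ^ n) x) : ℝ) : ℂ)‖ = _
    rw [hg2, Complex.norm_real]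
    exact norm_norm _
  calc ‖(R ^ n) x‖ = ‖(Rs ^ n) l x‖ := h1.symm
    _ ≤ ‖(Rs ^ n) l‖ * ‖x‖ := ContinuousLinearMap.le_opNorm _ _
    _ ≤ (1 / 4 * 1) * ‖x‖ := by
        gcongr
        exact (ContinuousLinearMap.le_opNorm _ _).trans (by gcongr)
    _ = 1 / 4 * ‖x‖ := by ring

lemma nwo_lin (B : E →L[ℝ] E)
    (hB : ∀ (μ : ℂ) (l : E →L[ℝ] ℂ), l ≠ 0 → (∀ x, l (B x) = μ * l x) → μ.re < 0) :
    ∃ (n : ℕ) (G : ℝ → E →L[ℝ] E) (M : ℝ), 0 < n ∧ (∀ x, G 0 x = x) ∧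
      (∀ x t, HasDerivAt (fun s => G s x) (B (G t x)) t) ∧
      (∀ t ∈ Set.Icc (0 : ℝ) n, ∀ x, ‖G t x‖ ≤ M * ‖x‖) ∧ 0 ≤ M ∧
      ∀ x, ‖G n x‖ ≤ 1 / 4 * ‖x‖ := by
  have : CompleteSpace E := FiniteDimensional.complete ℝ E
  obtain ⟨n, hn, hexp⟩ := nwo_spectral B hB
  have hder : ∀ t : ℝ, HasDerivAt (fun u : ℝ => NormedSpace.exp (u • B))
      (B * NormedSpace.exp (t • B)) t := fun t => hasDerivAt_exp_smul_const' B t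
  have hcont : Continuous (fun u : ℝ => NormedSpace.exp (u • B)) :=
    continuous_iff_continuousAt.2 fun t => (hder t).continuousAt
  obtain ⟨M1, hM1⟩ := (isCompact_Icc (a := (0 : ℝ)) (b := n)).exists_bound_of_continuousOn
    hcont.continuousOn
  have hM10 : 0 ≤ M1 := (norm_nonneg _).trans (hM1 0 ⟨le_rfl, Nat.cast_nonneg n⟩)
  refine ⟨n, fun t => NormedSpace.exp (t • B), M1, hn, by simp, fun x t => ?_,
    fun t ht x => ContinuousLinearMap.le_of_opNorm_le _ (hM1 t ht) x, hM10, fun x => ?_⟩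
  · have h1 := (hder t).clm_apply (hasDerivAt_const t x)
    simpa using h1
  · have h3 : NormedSpace.exp ((n : ℝ) • B) = NormedSpace.exp B ^ n := by
      letI : NormedAlgebra ℚ (E →L[ℝ] E) := NormedAlgebra.restrictScalars ℚ ℝ (E →L[ℝ] E)
      rw [← NormedSpace.exp_nsmul, Nat.cast_smul_eq_nsmul]
    exact ContinuousLinearMap.le_of_opNorm_le _ (h3 ▸ hexp : ‖NormedSpace.exp ((n : ℝ) • B)‖ ≤ 1 / 4) x
end spectral

section flow
variable {F : Type*} [NormedAddCommGroup F] [NormedSpace ℝ F]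

lemma nwo_lip_pos {v : F → F} {L : NNReal} (hv : LipschitzWith L v) {U : ℝ → F → F}
    (h0 : ∀ x, U 0 x = x) (hU : ∀ x t, HasDerivAt (fun s => U s x) (v (U t x)) t)
    (x y : F) (t : ℝ) (ht : 0 ≤ t) : ‖U t x - U t y‖ ≤ Real.exp (L * t) * ‖x - y‖ := by
  have := dist_le_of_trajectories_ODE (v := fun _ => v) (f := fun s => U s x) (g := fun s => U s y)
    (a := 0) (b := t) (δ := ‖x - y‖) (fun _ => hv)
    (fun s _ => (hU x s).continuousAt.continuousWithinAt) (fun s _ => (hU x s).hasDerivWithinAt)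
    (fun s _ => (hU y s).continuousAt.continuousWithinAt) (fun s _ => (hU y s).hasDerivWithinAt)
    (by simp [h0, dist_eq_norm]) t ⟨ht, le_rfl⟩
  rw [dist_eq_norm, sub_zero] at this
  linarith

lemma nwo_lip_neg {v : F → F} {L : NNReal} (hv : LipschitzWith L v) {U : ℝ → F → F}
    (h0 : ∀ x, U 0 x = x) (hU : ∀ x t, HasDerivAt (fun s => U s x) (v (U t x)) t)
    (x y : F) (t : ℝ) (ht : 0 ≤ t) : ‖U (-t) x - U (-t) y‖ ≤ Real.exp (L * t) * ‖x - y‖ := by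
  refine nwo_lip_pos (v := fun z => - v z) (U := fun t => U (-t)) hv.neg (by simpa using h0) ?_ x y t ht
  intro x t
  have := (hU x (-t)).scomp t (hasDerivAt_neg t)
  simpa [Function.comp_def] using this

lemma nwo_group {v : F → F} {L : NNReal} (hv : LipschitzWith L v) {U : ℝ → F → F}
    (h0 : ∀ x, U 0 x = x) (hU : ∀ x t, HasDerivAt (fun s => U s x) (v (U t x)) t)
    (x : F) (s t : ℝ) : U (t + s) x = U t (U s x) := by
  have := ODE_solution_unique_univ (v := fun _ => v) (s := fun _ => Set.univ) (K := L) (t₀ := 0)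
    (f := fun t => U (t + s) x) (g := fun t => U t (U s x))
    (fun _ => hv.lipschitzOnWith)
    (fun t => ⟨by simpa using (hU x (t + s)).comp_add_const t s, trivial⟩)
    (fun t => ⟨hU _ t, trivial⟩) (by simp [h0])
  exact congrFun this t

/-- approximation: forward comparison on [0,T] with constant error -/
lemma nwo_approx {v : F → F} {L : NNReal} (hv : LipschitzWith L v) (T : ℝ) (hT : 0 ≤ T) :
    ∃ C : ℝ, 0 ≤ C ∧ ∀ (f g f' : ℝ → F) (ε : ℝ), 0 ≤ ε → f 0 = g 0 →
      (∀ t, HasDerivAt f (f' t) t) → (∀ t ∈ Set.Icc 0 T, ‖f' t - v (f t)‖ ≤ ε) →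
      (∀ t, HasDerivAt g (v (g t)) t) → ∀ t ∈ Set.Icc 0 T, ‖f t - g t‖ ≤ C * ε := by
  refine ⟨gronwallBound 0 L 1 T, ?_, ?_⟩
  · have := gronwallBound_mono (δ := 0) (K := L) (ε := 1) le_rfl zero_le_one L.2 hT
    rwa [gronwallBound_x0] at this
  intro f g f' ε hε h0 hf hfe hg t ht
  have := dist_le_of_approx_trajectories_ODE (v := fun _ => v) (f := f) (g := g) (f' := f')
    (g' := fun t => v (g t)) (a := 0) (b := T) (δ := 0) (εf := ε) (εg := 0) (fun _ => hv)
    (fun s _ => (hf s).continuousAt.continuousWithinAt) (fun s _ => (hf s).hasDerivWithinAt)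
    (fun s hs => by rw [dist_eq_norm]; exact hfe s ⟨hs.1, hs.2.le⟩)
    (fun s _ => (hg s).continuousAt.continuousWithinAt) (fun s _ => (hg s).hasDerivWithinAt)
    (fun s hs => by simp)
    (by simp [h0]) t ht
  rw [dist_eq_norm, sub_zero, add_zero] at this
  refine this.trans ((gronwallBound_mono le_rfl hε L.2 ht.2).trans (le_of_eq ?_))
  by_cases hL : (L : ℝ) = 0
  · simp [gronwallBound, hL]; ring
  · simp [gronwallBound, hL]; ring

end flow

section spec2
open TensorProduct
lemma nwo_inj {F : Type*} [NormedAddCommGroup F] [NormedSpace ℝ F] [FiniteDimensional ℝ F]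
    (A : F →ₗ[ℝ] F) (hspec : ∀ μ : ℂ, μ.re = 0 →
      ¬ Module.End.HasEigenvalue (LinearMap.baseChange ℂ A) μ) (w : ℝ) (x : F)
    (hx : A (A x) + w ^ 2 • x = 0) : x = 0 := by
  by_contra hx0
  have hinj : Function.Injective (TensorProduct.mk ℝ ℂ F 1) :=
    Module.FaithfullyFlat.tensorProduct_mk_injective F
  have h1 : (1 : ℂ) ⊗ₜ[ℝ] x ≠ 0 := by
    intro h
    exact hx0 (hinj (by simpa using h))
  set z := (1 : ℂ) ⊗ₜ[ℝ] x
  have key : ∀ (μ : ℂ), μ.re = 0 → ∀ y, LinearMap.baseChange ℂ A y = μ • y → y = 0 := by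
    intro μ hμ y hy
    by_contra hy0
    exact hspec μ hμ (Module.End.hasEigenvalue_of_hasEigenvector
      ⟨Module.End.mem_eigenspace_iff.2 hy, hy0⟩)
  have hAz : LinearMap.baseChange ℂ A (LinearMap.baseChange ℂ A z) = -((w:ℂ) ^ 2 • z) := by
    have : A (A x) = - (w ^ 2 • x) := eq_neg_of_add_eq_zero_left hx
    simp only [z, LinearMap.baseChange_tmul, this, TensorProduct.tmul_neg]
    rw [TensorProduct.tmul_smul, TensorProduct.smul_tmul', TensorProduct.smul_tmul']
    simp
  have h2 : LinearMap.baseChange ℂ A z - (w * Complex.I) • z = 0 := by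
    apply key (-(w * Complex.I)) (by simp)
    rw [map_sub, map_smul, hAz, smul_sub, smul_smul]
    have : -(w * Complex.I) * (w * Complex.I) = (w:ℂ)^2 := by
      have := Complex.I_mul_I
      linear_combination (-(w:ℂ)^2) * this
    rw [this, neg_smul]; abel
  exact h1 (key (w * Complex.I) (by simp) z (sub_eq_zero.1 h2))
end spec2

section core
variable {F : Type*} [NormedAddCommGroup F] [NormedSpace ℝ F] [FiniteDimensional ℝ F]

lemma nwo_step {X X₀ : F → F} {L : NNReal} (hX : LipschitzWith L X) (hX₀ : LipschitzWith L X₀)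
    (hX₀zero : X₀ 0 = 0) {U U₀ : ℝ → F → F}
    (hU0 : ∀ x, U 0 x = x) (hU : ∀ x t, HasDerivAt (fun s => U s x) (X (U t x)) t)
    (hU₀0 : ∀ x, U₀ 0 x = x) (hU₀ : ∀ x t, HasDerivAt (fun s => U₀ s x) (X₀ (U₀ t x)) t)
    (hflat : ∀ m : ℕ, ∃ c : ℝ, 0 ≤ c ∧ ∀ z, ‖X z - X₀ z‖ ≤ c * ‖z‖ ^ m)
    (T : ℝ) (hT : 0 ≤ T) (m : ℕ) :
    ∃ C : ℝ, 0 ≤ C ∧ ∀ y, ∀ s ∈ Set.Icc 0 T, ‖U (-s) (U₀ s y) - y‖ ≤ C * ‖y‖ ^ m := by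
  obtain ⟨c, hc0, hc⟩ := hflat m
  obtain ⟨C, hC0, hC⟩ := nwo_approx hX T hT
  have hz : ∀ t, U₀ t 0 = 0 := by
    intro t
    have := ODE_solution_unique_univ (v := fun _ => X₀) (s := fun _ => Set.univ) (K := L) (t₀ := 0)
      (f := fun t => U₀ t 0) (g := fun t => 0)
      (fun _ => hX₀.lipschitzOnWith)
      (fun t => ⟨hU₀ _ t, trivial⟩)
      (fun t => ⟨by simpa [hX₀zero] using hasDerivAt_const t (0 : F), trivial⟩) (by simp [hU₀0])
    exact congrFun this t
  refine ⟨Real.exp (L * T) * (C * (c * Real.exp (L * T) ^ m)), by positivity, ?_⟩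
  intro y s hs
  have hn : ∀ t ∈ Set.Icc 0 T, ‖U₀ t y‖ ≤ Real.exp (L * T) * ‖y‖ := by
    intro t ht
    have := nwo_lip_pos hX₀ hU₀0 hU₀ y 0 t ht.1
    rw [hz, sub_zero, sub_zero] at this
    refine this.trans ?_
    have := ht.2
    gcongr
  have h1 := hC (fun t => U₀ t y) (fun t => U t y) (fun t => X₀ (U₀ t y))
    (c * (Real.exp (L * T) * ‖y‖) ^ m) (by positivity) (by simp [hU0, hU₀0]) (hU₀ y)
    (fun t ht => by
      rw [norm_sub_rev]
      refine (hc _).trans ?_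
      have := hn t ht
      gcongr) (hU y) s hs
  have h2 := nwo_lip_neg hX hU0 hU (U₀ s y) (U s y) s hs.1
  rw [← nwo_group hX hU0 hU y s (-s), neg_add_cancel, hU0] at h2
  calc _ ≤ _ := h2
    _ ≤ Real.exp (L * T) * (C * (c * (Real.exp (L * T) * ‖y‖) ^ m)) := by
        have := hs.2
        gcongr
    _ = _ := by rw [mul_pow]; ring

lemma nwo_core {X X₀ : F → F} {L : NNReal} (hX : LipschitzWith L X) (hX₀ : LipschitzWith L X₀)
    (hX₀zero : X₀ 0 = 0) {U U₀ : ℝ → F → F}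
    (hU0 : ∀ x, U 0 x = x) (hU : ∀ x t, HasDerivAt (fun s => U s x) (X (U t x)) t)
    (hU₀0 : ∀ x, U₀ 0 x = x) (hU₀ : ∀ x t, HasDerivAt (fun s => U₀ s x) (X₀ (U₀ t x)) t)
    (hflat : ∀ m : ℕ, ∃ c : ℝ, 0 ≤ c ∧ ∀ z, ‖X z - X₀ z‖ ≤ c * ‖z‖ ^ m)
    (E : Submodule ℝ F) (hE : ∀ x ∈ E, ∀ t, 0 ≤ t → U₀ t x ∈ E)
    (hatt : ∀ x ∈ E, Tendsto (fun t => U₀ t x) atTop (nhds 0))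
    (T δ : ℝ) (hT : 0 < T) (hδ : 0 < δ)
    (hcon : ∀ x ∈ E, ‖x‖ ≤ δ → ‖U₀ T x‖ ≤ 1 / 2 * ‖x‖) :
    ∃ W : F → F,
      (∀ x ∈ E, Tendsto (fun t => U (-t) (U₀ t x)) atTop (nhds (W x))) ∧
      ContinuousOn W (E : Set F) ∧
      (∀ m : ℕ, ∃ C > (0:ℝ), ∀ x ∈ E, ‖x‖ ≤ 1 → ‖W x - x‖ ≤ C * ‖x‖ ^ m) := by
  have hgr := nwo_group hX hU0 hU
  have hgr₀ := nwo_group hX₀ hU₀0 hU₀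
  have hcE : ∀ t, 0 ≤ t → Continuous (U₀ t) := fun t ht =>
    (LipschitzWith.of_dist_le_mul (K := Real.toNNReal (Real.exp (L * t))) fun x y => by
      simpa [dist_eq_norm, (Real.exp_pos _).le] using nwo_lip_pos hX₀ hU₀0 hU₀ x y t ht).continuous
  have hcU : ∀ t, 0 ≤ t → Continuous (U (-t)) := fun t ht =>
    (LipschitzWith.of_dist_le_mul (K := Real.toNNReal (Real.exp (L * t))) fun x y => by
      simpa [dist_eq_norm, (Real.exp_pos _).le] using nwo_lip_neg hX hU0 hU x y t ht).continuous
  have hF : ∀ s t x, U (-(t + s)) (U₀ (t + s) x) = U (-t) (U (-s) (U₀ s (U₀ t x))) := by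
    intro s t x
    rw [← hgr, ← hgr₀, neg_add, add_comm s t]
  have hcn : ∀ x ∈ E, ‖x‖ ≤ δ → ∀ n : ℕ, ‖U₀ (n * T) x‖ ≤ (1 / 2) ^ n * ‖x‖ := by
    intro x hx hxd n
    induction n with
    | zero => simp [hU₀0]
    | succ n ih =>
      have h1 : ((n + 1 : ℕ) : ℝ) * T = T + n * T := by push_cast; ring
      rw [h1, hgr₀]
      have h2 : ‖U₀ (n * T) x‖ ≤ δ := by
        refine ih.trans (le_trans ?_ hxd)
        exact mul_le_of_le_one_left (norm_nonneg _) (pow_le_one₀ (by norm_num) (by norm_num))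
      refine (hcon _ (hE x hx _ (by positivity)) h2).trans ?_
      rw [pow_succ]
      nlinarith
  obtain ⟨m₀, hm₀⟩ : ∃ m₀ : ℕ, ∀ m ≥ m₀, Real.exp (L * T) * (1 / 2) ^ m ≤ 1 / 2 := by
    have h1 : Tendsto (fun m : ℕ => Real.exp (L * T) * (1 / 2 : ℝ) ^ m) atTop (nhds 0) := by
      simpa using (tendsto_pow_atTop_nhds_zero_of_lt_one (r := (1 / 2 : ℝ)) (by norm_num)
        (by norm_num)).const_mul (Real.exp (L * T))
    exact eventually_atTop.1 (h1.eventually (ge_mem_nhds (by norm_num)))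
  have hloc : ∀ m ≥ m₀, ∃ C : ℝ, 0 ≤ C ∧ ∀ x ∈ E, ‖x‖ ≤ δ → ∀ (n : ℕ), ∀ s ∈ Set.Icc 0 T,
      ‖U (-(n * T + s)) (U₀ (n * T + s) x) - U (-(n * T)) (U₀ (n * T) x)‖
        ≤ C * ‖x‖ ^ m * (1 / 2) ^ n := by
    intro m hm
    obtain ⟨C, hC0, hC⟩ := nwo_step hX hX₀ hX₀zero hU0 hU hU₀0 hU₀ hflat T hT.le m
    refine ⟨C, hC0, fun x hx hxd n s hs => ?_⟩
    rw [hF]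
    refine (nwo_lip_neg hX hU0 hU _ _ (n * T) (by positivity)).trans ?_
    have h1 := hC (U₀ (n * T) x) s hs
    have h2 := hcn x hx hxd n
    calc _ ≤ Real.exp (L * (n * T)) * (C * ((1 / 2) ^ n * ‖x‖) ^ m) := by
          gcongr
          refine h1.trans ?_
          gcongr
      _ = C * ‖x‖ ^ m * (Real.exp (L * T) * (1 / 2) ^ m) ^ n := by
          have : (L : ℝ) * (n * T) = n * (L * T) := by ring
          rw [this, Real.exp_nat_mul, mul_pow, mul_pow, ← pow_mul, ← pow_mul, mul_comm n m]
          ring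
      _ ≤ _ := by
          gcongr
          exact hm₀ m hm
  have hdist : ∀ m ≥ m₀, ∃ C : ℝ, 0 ≤ C ∧ ∀ x ∈ E, ‖x‖ ≤ δ → ∀ w,
      Tendsto (fun t => U (-t) (U₀ t x)) atTop (nhds w) → ∀ n : ℕ,
        ‖U (-(n * T)) (U₀ (n * T) x) - w‖ ≤ C * ‖x‖ ^ m * (1 / 2) ^ n := by
    intro m hm
    obtain ⟨C, hC0, hC⟩ := hloc m hm
    refine ⟨2 * C, by positivity, fun x hx hxd w hw n => ?_⟩
    have h1 : Tendsto (fun n : ℕ => (n : ℝ) * T) atTop atTop :=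
      tendsto_natCast_atTop_atTop.atTop_mul_const hT
    have h2 := dist_le_of_le_geometric_of_tendsto (1 / 2) (C * ‖x‖ ^ m) (by norm_num)
      (f := fun n : ℕ => U (-(n * T)) (U₀ (n * T) x)) (fun n => by
        rw [dist_comm, dist_eq_norm]
        have := hC x hx hxd n T ⟨hT.le, le_rfl⟩
        have h1 : ((n + 1 : ℕ) : ℝ) * T = n * T + T := by push_cast; ring
        rwa [h1]) (hw.comp h1) n
    rw [dist_eq_norm] at h2
    refine h2.trans (le_of_eq ?_)
    ring
  have hexl : ∀ x ∈ E, ‖x‖ ≤ δ → ∃ w, Tendsto (fun t => U (-t) (U₀ t x)) atTop (nhds w) := by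
    intro x hx hxd
    obtain ⟨C, hC0, hC⟩ := hloc m₀ le_rfl
    obtain ⟨w, hw⟩ := cauchySeq_tendsto_of_complete (cauchySeq_of_le_geometric (1 / 2)
      (C * ‖x‖ ^ m₀) (by norm_num)
      (f := fun n : ℕ => U (-(n * T)) (U₀ (n * T) x)) (fun n => by
        rw [dist_comm, dist_eq_norm]
        have := hC x hx hxd n T ⟨hT.le, le_rfl⟩
        have h1 : ((n + 1 : ℕ) : ℝ) * T = n * T + T := by push_cast; ring
        rwa [h1]))
    refine ⟨w, ?_⟩
    rw [tendsto_iff_norm_sub_tendsto_zero] at hw ⊢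
    have h2 : Tendsto (fun n : ℕ => C * ‖x‖ ^ m₀ * (1 / 2 : ℝ) ^ n
        + ‖U (-(n * T)) (U₀ (n * T) x) - w‖) atTop (nhds 0) := by
      simpa using ((tendsto_pow_atTop_nhds_zero_of_lt_one (r := (1 / 2 : ℝ)) (by norm_num)
        (by norm_num)).const_mul (C * ‖x‖ ^ m₀)).add hw
    have h3 : Tendsto (fun t : ℝ => ⌊t / T⌋₊) atTop atTop :=
      tendsto_nat_floor_atTop.comp (tendsto_id.atTop_div_const hT)
    refine squeeze_zero' (Eventually.of_forall fun t => norm_nonneg _) ?_ (h2.comp h3)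
    filter_upwards [eventually_ge_atTop 0] with t ht
    simp only [Function.comp_apply]
    set n := ⌊t / T⌋₊
    have h4 : (n : ℝ) * T ≤ t := by
      rw [← le_div_iff₀ hT]; exact Nat.floor_le (by positivity)
    have h5 : t < (n + 1) * T := by
      rw [← div_lt_iff₀ hT]; exact Nat.lt_floor_add_one _
    have h6 := hC x hx hxd n (t - n * T) ⟨by linarith, by linarith⟩
    rw [add_sub_cancel] at h6
    calc _ = ‖(U (-t) (U₀ t x) - U (-(n * T)) (U₀ (n * T) x))
          + (U (-(n * T)) (U₀ (n * T) x) - w)‖ := by congr 1; abel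
      _ ≤ _ := (norm_add_le _ _).trans (by gcongr)
  have hsmall : ∀ x ∈ E, ∃ t₀, 0 ≤ t₀ ∧ ‖U₀ t₀ x‖ < δ := by
    intro x hx
    have h1 := ((hatt x hx).norm.eventually (gt_mem_nhds (by simpa using hδ)))
    obtain ⟨t, h2, h3⟩ := (h1.and (eventually_ge_atTop 0)).exists
    exact ⟨t, h3, h2⟩
  have hshift : ∀ x t₀ w, 0 ≤ t₀ → Tendsto (fun t => U (-t) (U₀ t (U₀ t₀ x))) atTop (nhds w) →
      Tendsto (fun t => U (-t) (U₀ t x)) atTop (nhds (U (-t₀) w)) := by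
    intro x t₀ w ht hw
    have h1 := (((hcU t₀ ht).tendsto w).comp hw).comp
      (tendsto_atTop_add_const_right atTop (-t₀) tendsto_id)
    refine h1.congr fun t => ?_
    simp only [Function.comp_apply, id]
    rw [← hF]
    congr 2 <;> ring
  have hex : ∀ x : F, ∃ w, x ∈ E → Tendsto (fun t => U (-t) (U₀ t x)) atTop (nhds w) := by
    intro x
    by_cases hx : x ∈ E
    · obtain ⟨t₀, ht, hd⟩ := hsmall x hx
      obtain ⟨w, hw⟩ := hexl _ (hE x hx t₀ ht) hd.le
      exact ⟨_, fun _ => hshift x t₀ w ht hw⟩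
    · exact ⟨0, fun h => absurd h hx⟩
  choose W hW using hex
  have hWloc : ContinuousOn W ((E : Set F) ∩ Metric.closedBall 0 δ) := by
    obtain ⟨C, hC0, hC⟩ := hdist m₀ le_rfl
    have hu : TendstoUniformlyOn (fun (n : ℕ) x => U (-(n * T)) (U₀ (n * T) x)) W atTop
        ((E : Set F) ∩ Metric.closedBall 0 δ) := by
      rw [Metric.tendstoUniformlyOn_iff]
      intro ε hε
      have h1 : Tendsto (fun n : ℕ => C * δ ^ m₀ * (1 / 2 : ℝ) ^ n) atTop (nhds 0) := by
        simpa using (tendsto_pow_atTop_nhds_zero_of_lt_one (r := (1 / 2 : ℝ)) (by norm_num)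
          (by norm_num)).const_mul (C * δ ^ m₀)
      filter_upwards [h1.eventually (gt_mem_nhds hε)] with n hn x hx
      have hxd : ‖x‖ ≤ δ := by simpa using hx.2
      rw [dist_comm, dist_eq_norm]
      refine lt_of_le_of_lt ((hC x hx.1 hxd _ (hW x hx.1) n).trans ?_) hn
      gcongr
    refine hu.continuousOn (Eventually.frequently (Eventually.of_forall fun n => ?_))
    have h0 : (0 : ℝ) ≤ n * T := by positivity
    exact ((hcU _ h0).comp (hcE _ h0)).continuousOn
  have hWc : ContinuousOn W (E : Set F) := by
    intro x hx
    obtain ⟨t₀, ht, hd⟩ := hsmall x hx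
    have hopen : {y | ‖U₀ t₀ y‖ < δ} ∈ nhds x :=
      (isOpen_lt (hcE t₀ ht).norm continuous_const).mem_nhds hd
    rw [← continuousWithinAt_inter hopen]
    have hmaps : Set.MapsTo (U₀ t₀) ((E : Set F) ∩ {y | ‖U₀ t₀ y‖ < δ})
        ((E : Set F) ∩ Metric.closedBall 0 δ) := fun y hy =>
      ⟨hE y hy.1 t₀ ht, by simpa using (le_of_lt hy.2)⟩
    have h1 : ContinuousOn (fun y => U (-t₀) (W (U₀ t₀ y)))
        ((E : Set F) ∩ {y | ‖U₀ t₀ y‖ < δ}) :=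
      (hcU t₀ ht).comp_continuousOn (hWloc.comp (hcE t₀ ht).continuousOn hmaps)
    refine (h1 x ⟨hx, hd⟩).congr (fun y hy => ?_) ?_
    · exact tendsto_nhds_unique (hW y hy.1) (hshift y t₀ _ ht (hW _ (hE y hy.1 t₀ ht)))
    · exact tendsto_nhds_unique (hW x hx) (hshift x t₀ _ ht (hW _ (hE x hx t₀ ht)))
  refine ⟨W, fun x hx => hW x hx, hWc, fun m => ?_⟩
  obtain ⟨C, hC0, hC⟩ := hdist (max m m₀) (le_max_right _ _)
  have : ProperSpace F := FiniteDimensional.proper ℝ F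
  have hcomp : IsCompact ((E : Set F) ∩ Metric.closedBall 0 1) :=
    (isCompact_closedBall (0 : F) 1).inter_left E.closed_of_finiteDimensional
  obtain ⟨D, hD⟩ := hcomp.exists_bound_of_continuousOn (f := fun x => W x - x)
    ((hWc.mono Set.inter_subset_left).sub continuousOn_id)
  have hD0 : 0 ≤ D := (norm_nonneg _).trans (hD 0 ⟨E.zero_mem, by simp⟩)
  refine ⟨C + D / δ ^ m + 1, by positivity, fun x hx hx1 => ?_⟩
  rcases le_or_gt ‖x‖ δ with h | h
  · have h1 := hC x hx h _ (hW x hx) 0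
    simp only [Nat.cast_zero, zero_mul, neg_zero, hU0, hU₀0, pow_zero, mul_one] at h1
    rw [norm_sub_rev]
    refine h1.trans ?_
    have h2 : ‖x‖ ^ (max m m₀) ≤ ‖x‖ ^ m :=
      pow_le_pow_of_le_one (norm_nonneg _) hx1 (le_max_left _ _)
    have h3 : C ≤ C + D / δ ^ m + 1 := by
      have : 0 ≤ D / δ ^ m := by positivity
      linarith
    gcongr
  · have h1 := hD x ⟨hx, by simpa using hx1⟩
    have h2 : δ ^ m ≤ ‖x‖ ^ m := by gcongr
    calc _ ≤ D := h1
      _ = D / δ ^ m * δ ^ m := by field_simp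
      _ ≤ (C + D / δ ^ m + 1) * ‖x‖ ^ m := by
        gcongr
        linarith
end core

section contr
variable {F : Type*} [NormedAddCommGroup F] [InnerProductSpace ℝ F] [FiniteDimensional ℝ F]

lemma nwo_stay {X₀ : F → F} {L : NNReal} (hX₀ : LipschitzWith L X₀) {U₀ : ℝ → F → F}
    (hU₀0 : ∀ x, U₀ 0 x = x) (hU₀ : ∀ x t, HasDerivAt (fun s => U₀ s x) (X₀ (U₀ t x)) t)
    (E : Submodule ℝ F) (hE : ∀ x ∈ E, X₀ x ∈ E) (x : F) (hx : x ∈ E) (t : ℝ) (ht : 0 ≤ t) :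
    U₀ t x ∈ E := by
  let P : F →L[ℝ] F := E.starProjection
  let Q : F →L[ℝ] F := ContinuousLinearMap.id ℝ F - P
  have hQ : ∀ y ∈ E, Q y = 0 := by
    intro y hy
    have : P y = y := Submodule.starProjection_eq_self_iff.2 hy
    simp [Q, this]
  have hP : ∀ y, P y ∈ E := fun y => Submodule.starProjection_apply_mem E y
  have h := eq_zero_of_abs_deriv_le_mul_abs_self_of_eq_zero_right (a := 0) (b := t)
    (f := fun s => Q (U₀ s x)) (f' := fun s => Q (X₀ (U₀ s x))) (K := ‖Q‖ * L)
    (fun s _ => (Q.continuous.continuousAt.comp (hU₀ x s).continuousAt).continuousWithinAt)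
    (fun s _ => (Q.hasFDerivAt.comp_hasDerivAt s (hU₀ x s)).hasDerivWithinAt)
    (by simp [hU₀0, hQ x hx])
    (fun s _ => by
      have h1 : Q (X₀ (U₀ s x)) = Q (X₀ (U₀ s x) - X₀ (P (U₀ s x))) := by
        rw [map_sub, hQ _ (hE _ (hP _)), sub_zero]
      rw [h1, mul_assoc]
      refine (Q.le_opNorm _).trans ?_
      gcongr
      exact hX₀.norm_sub_le _ _) t ⟨ht, le_rfl⟩
  have h2 : U₀ t x = P (U₀ t x) := by
    simpa [Q, sub_eq_zero] using h
  rw [h2]; exact hP _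

lemma nwo_unstable {X₀ : F → F} {A : F →L[ℝ] F} {U₀ : ℝ → F → F}
    (hU₀0 : ∀ x, U₀ 0 x = x) (hU₀ : ∀ x t, HasDerivAt (fun s => U₀ s x) (X₀ (U₀ t x)) t)
    (E : Submodule ℝ F) (hE : ∀ x ∈ E, ∀ t, 0 ≤ t → U₀ t x ∈ E)
    (hatt : ∀ x ∈ E, Tendsto (fun t => U₀ t x) atTop (nhds 0))
    (M : ℝ) (hM : ∀ z, ‖X₀ z - A z‖ ≤ M)
    (k : F →L[ℝ] ℂ) (μ : ℂ) (hμ : 0 < μ.re) (hk : ∀ x ∈ E, k (A x) = μ * k x)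
    (x : F) (hx : x ∈ E) : k x = 0 := by
  by_contra hkx
  have hM0 : 0 ≤ M := (norm_nonneg _).trans (hM 0)
  set M' := ‖k‖ * M
  have hM'0 : 0 ≤ M' := by positivity
  have hkp : 0 < ‖k x‖ := norm_pos_iff.2 hkx
  let y := ((M' / μ.re + 1) / ‖k x‖) • x
  have hy : y ∈ E := E.smul_mem _ hx
  have hky : ‖k y‖ = M' / μ.re + 1 := by
    have : 0 ≤ M' / μ.re + 1 := by positivity
    simp only [y, map_smul, norm_smul, norm_div, norm_norm]
    rw [Real.norm_of_nonneg this]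
    field_simp
  let ψ : ℝ → ℂ := fun t => Complex.exp (-μ * t) * k (U₀ t y)
  have hψ : ∀ t : ℝ, HasDerivAt ψ (Complex.exp (-μ * t) * (k (X₀ (U₀ t y)) - μ * k (U₀ t y))) t := by
    intro t
    have h1 : HasDerivAt (fun t : ℝ => Complex.exp (-μ * t)) (Complex.exp (-μ * t) * (-μ)) t := by
      have h0 : HasDerivAt (fun t : ℝ => -μ * (t : ℂ)) (-μ) t := by
        simpa using (Complex.ofRealCLM.hasDerivAt (x := t)).const_mul (-μ)
      exact h0.cexp
    have h2 : HasDerivAt (fun t => k (U₀ t y)) (k (X₀ (U₀ t y))) t :=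
      k.hasFDerivAt.comp_hasDerivAt t (hU₀ y t)
    exact (h1.fun_mul h2).congr_deriv (by ring)
  have hnexp : ∀ t : ℝ, ‖Complex.exp (-μ * t)‖ = Real.exp (-μ.re * t) := by
    intro t; rw [Complex.norm_exp]; simp
  have hbd : ∀ t, 0 ≤ t → ‖ψ t - ψ 0‖ ≤ M' / μ.re * (1 - Real.exp (-μ.re * t)) := by
    intro t ht
    refine image_norm_le_of_norm_deriv_right_le_deriv_boundary (a := 0) (b := t)
      (f := fun t => ψ t - ψ 0)
      (f' := fun t => Complex.exp (-μ * t) * (k (X₀ (U₀ t y)) - μ * k (U₀ t y)))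
      (B := fun t => M' / μ.re * (1 - Real.exp (-μ.re * t)))
      (B' := fun t => M' * Real.exp (-μ.re * t))
      (fun s _ => ((hψ s).sub_const _).continuousAt.continuousWithinAt)
      (fun s _ => ((hψ s).sub_const _).hasDerivWithinAt) (by simp) ?_ ?_ ⟨ht, le_rfl⟩
    · intro s
      have h0 : HasDerivAt (fun s : ℝ => -μ.re * s) (-μ.re) s := by
        simpa using (hasDerivAt_id s).const_mul (-μ.re)
      refine ((h0.exp.const_sub 1).const_mul (M' / μ.re)).congr_deriv ?_
      field_simp
    · intro s hs
      rw [norm_mul, hnexp, mul_comm]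
      gcongr
      rw [← hk _ (hE y hy s hs.1), ← map_sub]
      exact (k.le_opNorm _).trans (mul_le_mul_of_nonneg_left (hM _) (norm_nonneg _))
  have hge : ∀ t, 0 ≤ t → 1 ≤ ‖k (U₀ t y)‖ := by
    intro t ht
    have h1 := hbd t ht
    have h2 : ψ 0 = k y := by simp [ψ, hU₀0]
    have h3 : ‖ψ 0‖ ≤ ‖ψ t‖ + ‖ψ t - ψ 0‖ := by
      rw [norm_sub_rev]
      calc ‖ψ 0‖ = ‖ψ t + (ψ 0 - ψ t)‖ := by congr 1; ring
        _ ≤ _ := norm_add_le _ _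
    rw [h2, hky] at h3
    rw [h2] at h1
    have h4 : M' / μ.re * (1 - Real.exp (-μ.re * t)) ≤ M' / μ.re := by
      apply mul_le_of_le_one_right (by positivity)
      have := Real.exp_pos (-μ.re * t)
      linarith
    have h5 : ‖ψ t‖ = Real.exp (-μ.re * t) * ‖k (U₀ t y)‖ := by
      simp only [ψ, norm_mul, hnexp]
    have h6 : Real.exp (-μ.re * t) ≤ 1 := Real.exp_le_one_iff.2 (by nlinarith)
    have h7 : Real.exp (-μ.re * t) * ‖k (U₀ t y)‖ ≤ ‖k (U₀ t y)‖ :=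
      mul_le_of_le_one_left (norm_nonneg _) h6
    linarith
  have hlim : Tendsto (fun t => ‖k (U₀ t y)‖) atTop (nhds 0) := by
    have := ((k.continuous.tendsto 0).comp (hatt y hy)).norm
    simpa using this
  obtain ⟨t, h1, h2⟩ := ((hlim.eventually (gt_mem_nhds one_pos)).and (eventually_ge_atTop 0)).exists
  exact absurd (hge t h2) (not_le.2 h1)

lemma nwo_contr {X₀ : F → F} {L : NNReal} (hX₀ : LipschitzWith L X₀) (hX₀zero : X₀ 0 = 0)
    {A : F →L[ℝ] F} (hA : HasFDerivAt X₀ A 0) {U₀ : ℝ → F → F}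
    (hU₀0 : ∀ x, U₀ 0 x = x) (hU₀ : ∀ x t, HasDerivAt (fun s => U₀ s x) (X₀ (U₀ t x)) t)
    (E : Submodule ℝ F) (hE : ∀ x ∈ E, ∀ t, 0 ≤ t → U₀ t x ∈ E)
    (hAE : ∀ x ∈ E, A x ∈ E)
    (hatt : ∀ x ∈ E, Tendsto (fun t => U₀ t x) atTop (nhds 0))
    (M : ℝ) (hM : ∀ z, ‖X₀ z - A z‖ ≤ M)
    (hinj : ∀ (w : ℝ) (x : F), A (A x) + w ^ 2 • x = 0 → x = 0) :
    ∃ T δ : ℝ, 0 < T ∧ 0 < δ ∧ ∀ x ∈ E, ‖x‖ ≤ δ → ‖U₀ T x‖ ≤ 1 / 2 * ‖x‖ := by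
  let B : E →L[ℝ] E := LinearMap.toContinuousLinearMap ((A : F →ₗ[ℝ] F).restrict hAE)
  have hB : ∀ x : E, ((B x : E) : F) = A x := fun x => rfl
  have hsp : ∀ (μ : ℂ) (l : E →L[ℝ] ℂ), l ≠ 0 → (∀ x, l (B x) = μ * l x) → μ.re < 0 := by
    intro μ l hl h
    by_contra hre
    rcases (not_lt.1 hre).eq_or_lt with h0 | hpos
    · let S : E →ₗ[ℝ] E := (B : E →ₗ[ℝ] E) * (B : E →ₗ[ℝ] E) + (μ.im ^ 2) • (1 : Module.End ℝ E)
      have hSx : ∀ x, S x = B (B x) + μ.im ^ 2 • x := fun x => rfl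
      have hSi : Function.Injective S := by
        rw [injective_iff_map_eq_zero]
        intro x hx
        apply Subtype.ext
        apply hinj μ.im
        have := congrArg (Subtype.val) hx
        rw [hSx] at this
        simpa [hB] using this
      have hSs := LinearMap.injective_iff_surjective.1 hSi
      apply hl
      ext x
      obtain ⟨y, rfl⟩ := hSs x
      rw [hSx, map_add, map_smul, h, h]
      have : μ = μ.im * Complex.I := by
        apply Complex.ext <;> simp [← h0]
      have h2 : μ * μ = -(μ.im : ℂ) ^ 2 := by
        have h3 := Complex.I_mul_I
        calc μ * μ = (μ.im * Complex.I) * (μ.im * Complex.I) := by rw [← this]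
          _ = _ := by linear_combination (μ.im : ℂ) ^ 2 * h3
      rw [Complex.real_smul, ← mul_assoc, h2]
      push_cast
      simp
    · apply hl
      ext x
      have := nwo_unstable (A := A) hU₀0 hU₀ E hE hatt M hM (l.comp E.orthogonalProjectionOnto) μ hpos
        (fun z hz => by
          have h1 : E.orthogonalProjectionOnto z = ⟨z, hz⟩ :=
            Submodule.orthogonalProjectionOnto_mem_subspace_eq_self (K := E) ⟨z, hz⟩
          have h2 : E.orthogonalProjectionOnto (A z) = B ⟨z, hz⟩ :=
            Submodule.orthogonalProjectionOnto_mem_subspace_eq_self (K := E) (B ⟨z, hz⟩)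
          change l (E.orthogonalProjectionOnto (A z)) = μ * l (E.orthogonalProjectionOnto z)
          rw [h2, h1, h]) x x.2
      change l (E.orthogonalProjectionOnto (x : F)) = 0 at this
      rwa [Submodule.orthogonalProjectionOnto_mem_subspace_eq_self] at this
  obtain ⟨n, G, M1, hn, hG0, hG, hM1, hM10, hGn⟩ := nwo_lin B hsp
  have hT : (0 : ℝ) < n := by exact_mod_cast hn
  obtain ⟨C, hC0, hC⟩ := nwo_approx hX₀ n hT.le
  let ε : ℝ := 1 / (4 * (C * M1 + 1))
  have hε : 0 < ε := by positivity
  have hCε : C * (ε * M1) ≤ 1 / 4 := by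
    have : C * (ε * M1) = (1 / 4) * ((C * M1) / (C * M1 + 1)) := by
      simp only [ε]; field_simp
    rw [this]
    have h2 : (C * M1) / (C * M1 + 1) ≤ 1 := by
      rw [div_le_one (by positivity)]; linarith
    linarith
  have hlo := hA.isLittleO.bound hε
  simp only [hX₀zero, sub_zero] at hlo
  obtain ⟨η, hη, hball⟩ := Metric.eventually_nhds_iff.1 hlo
  refine ⟨n, η / (M1 + 1) / 2, hT, by positivity, fun x hx hxd => ?_⟩
  let f : ℝ → F := fun t => ((G t ⟨x, hx⟩ : E) : F)
  have hf : ∀ t, HasDerivAt f (A (f t)) t := by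
    intro t
    exact E.subtypeL.hasFDerivAt.comp_hasDerivAt t (hG ⟨x, hx⟩ t)
  have hfn : ∀ t ∈ Set.Icc (0 : ℝ) n, ‖f t‖ ≤ M1 * ‖x‖ := fun t ht => hM1 t ht ⟨x, hx⟩
  have h1 := hC f (fun t => U₀ t x) (fun t => A (f t)) (ε * (M1 * ‖x‖)) (by positivity)
    (by simp [f, hU₀0, hG0]) hf (fun t ht => by
      have hft := hfn t ht
      have : dist (f t) 0 < η := by
        rw [dist_zero_right]
        refine lt_of_le_of_lt hft ?_
        calc M1 * ‖x‖ ≤ (M1 + 1) * (η / (M1 + 1) / 2) := by gcongr; linarith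
          _ = η / 2 := by field_simp
          _ < η := by linarith
      have := hball this
      rw [norm_sub_rev]
      exact this.trans (by gcongr)) (hU₀ x) n ⟨hT.le, le_rfl⟩
  have h2 : ‖f n‖ ≤ 1 / 4 * ‖x‖ := hGn ⟨x, hx⟩
  calc ‖U₀ n x‖ = ‖f n - (f n - U₀ n x)‖ := by congr 1; abel
    _ ≤ ‖f n‖ + ‖f n - U₀ n x‖ := norm_sub_le _ _
    _ ≤ 1 / 4 * ‖x‖ + C * (ε * M1) * ‖x‖ := by
        gcongr
        refine h1.trans (le_of_eq (by ring))
    _ ≤ 1 / 4 * ‖x‖ + 1 / 4 * ‖x‖ := by gcongr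
    _ = _ := by ring
end contr

/-- **Sternberg/Nelson wave operator existence.**
Let `X, X₀` be smooth vector fields on `ℝ^N` with `X₀ 0 = 0`, whose difference vanishes to
infinite order at `0`, and which agree outside a compact set with their common linearization
`A = DX(0)`, assumed to have no purely imaginary complex eigenvalue.  Let `U, U₀` be the
complete flows of `X, X₀`, and let `E` be a linear subspace invariant under `X₀` on which
`U₀(t)x → 0` as `t → ∞`.  Then `W₋ x = lim_{t→∞} U(-t)(U₀(t)x)` exists for `x ∈ E`,
is continuous on `E`, and `W₋ - id` vanishes to infinite order at `0` along `E`. -/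
theorem nelson_wave_operator {N : ℕ}
    (X X₀ : EuclideanSpace ℝ (Fin N) → EuclideanSpace ℝ (Fin N))
    (hXsmooth : ContDiff ℝ (⊤ : ℕ∞) X) (hX₀smooth : ContDiff ℝ (⊤ : ℕ∞) X₀)
    (hX₀zero : X₀ 0 = 0)
    (A : EuclideanSpace ℝ (Fin N) →L[ℝ] EuclideanSpace ℝ (Fin N))
    (hA : HasFDerivAt X A 0)
    (hflat : ∀ m : ℕ, ∃ c > (0:ℝ), ∃ δ > (0:ℝ), ∀ z : EuclideanSpace ℝ (Fin N),
      ‖z‖ ≤ δ → ‖X z - X₀ z‖ ≤ c * ‖z‖ ^ m)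
    (K : Set (EuclideanSpace ℝ (Fin N))) (hK : IsCompact K)
    (hlin : ∀ z ∉ K, X z = A z ∧ X₀ z = A z)
    (hspec : ∀ μ : ℂ, μ.re = 0 →
      ¬ Module.End.HasEigenvalue
          (LinearMap.baseChange ℂ (A : EuclideanSpace ℝ (Fin N) →ₗ[ℝ] EuclideanSpace ℝ (Fin N))) μ)
    (U U₀ : ℝ → EuclideanSpace ℝ (Fin N) → EuclideanSpace ℝ (Fin N))
    (hU0 : ∀ x, U 0 x = x)
    (hUflow : ∀ x t, HasDerivAt (fun s => U s x) (X (U t x)) t)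
    (hU₀0 : ∀ x, U₀ 0 x = x)
    (hU₀flow : ∀ x t, HasDerivAt (fun s => U₀ s x) (X₀ (U₀ t x)) t)
    (E : Submodule ℝ (EuclideanSpace ℝ (Fin N)))
    (hEinv : ∀ x ∈ E, X₀ x ∈ E)
    (hEattract : ∀ x ∈ E, Tendsto (fun t => U₀ t x) atTop (nhds 0)) :
    ∃ W : EuclideanSpace ℝ (Fin N) → EuclideanSpace ℝ (Fin N),
      (∀ x ∈ E, Tendsto (fun t => U (-t) (U₀ t x)) atTop (nhds (W x))) ∧
      ContinuousOn W (E : Set (EuclideanSpace ℝ (Fin N))) ∧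
      (∀ m : ℕ, ∃ C > (0:ℝ), ∀ x ∈ E, ‖x‖ ≤ 1 → ‖W x - x‖ ≤ C * ‖x‖ ^ m) := by
  have hKb : ∃ R : ℝ, 0 < R ∧ ∀ z ∈ K, ‖z‖ ≤ R := hK.isBounded.exists_pos_norm_le
  obtain ⟨R, hR, hRK⟩ := hKb
  have hlip : ∀ Y : EuclideanSpace ℝ (Fin N) → EuclideanSpace ℝ (Fin N),
      ContDiff ℝ (⊤ : ℕ∞) Y → (∀ z ∉ K, Y z = A z) →
      (∃ C, LipschitzWith C Y) ∧ ∃ M, ∀ z, ‖Y z - A z‖ ≤ M := by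
    intro Y hY hYA
    have hs : HasCompactSupport (fun z => Y z - A z) :=
      HasCompactSupport.intro hK fun z hz => by simp [hYA z hz]
    have hc : ContDiff ℝ (⊤ : ℕ∞) (fun z => Y z - A z) := hY.sub A.contDiff
    obtain ⟨C, hC⟩ := hc.lipschitzWith_of_hasCompactSupport hs (by simp)
    refine ⟨⟨C + ‖A‖₊, ?_⟩, hs.exists_bound_of_continuous hc.continuous⟩
    have := hC.add A.lipschitz
    simpa using this
  obtain ⟨⟨L1, hL1⟩, M1, hM1⟩ := hlip X hXsmooth fun z hz => (hlin z hz).1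
  obtain ⟨⟨L2, hL2⟩, M2, hM2⟩ := hlip X₀ hX₀smooth fun z hz => (hlin z hz).2
  have hX : LipschitzWith (max L1 L2) X := hL1.weaken (le_max_left _ _)
  have hX₀ : LipschitzWith (max L1 L2) X₀ := hL2.weaken (le_max_right _ _)
  have hflat' : ∀ m : ℕ, ∃ c : ℝ, 0 ≤ c ∧ ∀ z, ‖X z - X₀ z‖ ≤ c * ‖z‖ ^ m := by
    intro m
    obtain ⟨c, hc, δ, hδ, h⟩ := hflat m
    have hM : ∀ z, ‖X z - X₀ z‖ ≤ M1 + M2 := by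
      intro z
      calc ‖X z - X₀ z‖ = ‖(X z - A z) - (X₀ z - A z)‖ := by congr 1; abel
        _ ≤ _ := (norm_sub_le _ _).trans (add_le_add (hM1 z) (hM2 z))
    have hM0 : 0 ≤ M1 + M2 := (norm_nonneg _).trans (hM 0)
    refine ⟨c + (M1 + M2) / δ ^ m, by positivity, fun z => ?_⟩
    rcases le_or_gt ‖z‖ δ with hz | hz
    · refine (h z hz).trans ?_
      have : 0 ≤ (M1 + M2) / δ ^ m := by positivity
      gcongr
      linarith
    · have h2 : δ ^ m ≤ ‖z‖ ^ m := by gcongr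
      calc _ ≤ M1 + M2 := hM z
        _ = (M1 + M2) / δ ^ m * δ ^ m := by field_simp
        _ ≤ _ := by
          gcongr
          linarith
  have hA₀ : HasFDerivAt X₀ A 0 := by
    obtain ⟨c, hc, h⟩ := hflat' 2
    have h1 : HasFDerivAt (fun z => X z - X₀ z)
        (0 : EuclideanSpace ℝ (Fin N) →L[ℝ] EuclideanSpace ℝ (Fin N)) 0 := by
      have h0 : X 0 - X₀ 0 = 0 := by
        have := h 0
        simpa using this
      rw [hasFDerivAt_iff_isLittleO_nhds_zero]
      simp only [zero_add, h0, sub_zero, zero_apply]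
      have h2 : (fun z => X z - X₀ z) =O[nhds 0]
          (fun z : EuclideanSpace ℝ (Fin N) => ‖z‖ ^ 2) :=
        Asymptotics.IsBigO.of_bound c (Eventually.of_forall fun z => by simpa using h z)
      exact h2.trans_isLittleO (Asymptotics.isLittleO_norm_pow_id one_lt_two)
    have h3 := hA.sub h1
    have h4 : (X - fun z => X z - X₀ z) = X₀ := by funext z; simp
    rw [h4, sub_zero] at h3
    exact h3
  have hAE : ∀ x ∈ E, A x ∈ E := by
    intro x hx
    by_cases hx0 : x = 0
    · simp [hx0]
    have hxp : 0 < ‖x‖ := norm_pos_iff.2 hx0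
    have hc : (R + 1) / ‖x‖ ≠ 0 := by positivity
    have hnot : ((R + 1) / ‖x‖) • x ∉ K := by
      intro hmem
      have := hRK _ hmem
      rw [norm_smul, Real.norm_of_nonneg (by positivity), div_mul_cancel₀ _ hxp.ne'] at this
      linarith
    have h1 := hEinv _ (E.smul_mem ((R + 1) / ‖x‖) hx)
    rw [(hlin _ hnot).2, map_smul] at h1
    exact (E.smul_mem_iff hc).1 h1
  have hstay := nwo_stay hX₀ hU₀0 hU₀flow E hEinv
  obtain ⟨T, δ, hT, hδ, hcon⟩ := nwo_contr hX₀ hX₀zero hA₀ hU₀0 hU₀flow E hstay hAE hEattract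
    M2 hM2 (nwo_inj (A : EuclideanSpace ℝ (Fin N) →ₗ[ℝ] EuclideanSpace ℝ (Fin N)) hspec)
  exact nwo_core hX hX₀ hX₀zero hU0 hUflow hU₀0 hU₀flow hflat' E hstay hEattract T δ hT hδ hcon
end

section
/- Let X₀ : ℝ^N → ℝ^N be a smooth vector field with X₀(0) = 0 which coincides outside some compact set with the linear vector field z ↦ Az, where A = DX₀(0) is the linearization of X₀ at 0 and has no purely imaginary complex eigenvalue. Let U₀ be the (complete) flow of X₀ and let E ⊆ ℝ^N be a linear subspace with X₀(x) ∈ E for all x ∈ E, such that U₀(t)x → 0 as t → +∞ for every x ∈ E. Then there exist constants C, c > 0 such that ‖U₀(t)x‖ ≤ C e^{−ct} ‖x‖ for all x ∈ E and all t ≥ 0. -/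
open Filter

theorem aux_exp_deriv {V : Type*} [NormedAddCommGroup V] [NormedSpace ℝ V] [FiniteDimensional ℝ V]
    (B : V →L[ℝ] V) (x : V) (t : ℝ) :
    HasDerivAt (fun s : ℝ => NormedSpace.exp (s • B) x) (B (NormedSpace.exp (t • B) x)) t := by
  have : CompleteSpace V := FiniteDimensional.complete ℝ V
  have h := hasDerivAt_exp_smul_const' (𝕂 := ℝ) B t
  exact ((ContinuousLinearMap.apply ℝ V x).hasFDerivAt.comp_hasDerivAt t h)

theorem aux_eig {V : Type*} [NormedAddCommGroup V] [NormedSpace ℝ V] [FiniteDimensional ℝ V]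
    (B : V →L[ℝ] V) (l : V →L[ℝ] ℂ) (μ : ℂ) (hl : ∀ x, l (B x) = μ * l x) (x : V) (t : ℝ) :
    l (NormedSpace.exp (t • B) x) = Complex.exp (t * μ) * l x := by
  have key : (fun t : ℝ => l (NormedSpace.exp (t • B) x)) =
      fun t : ℝ => Complex.exp (t * μ) * l x := by
    refine ODE_solution_unique_univ (v := fun _ z => μ * z) (s := fun _ => Set.univ)
      (K := ‖μ‖₊) (t₀ := 0) ?_ ?_ ?_ ?_
    · intro t
      refine (LipschitzWith.of_dist_le_mul fun a b => ?_).lipschitzOnWith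
      simp [dist_eq_norm, ← mul_sub]
    · intro t
      refine ⟨?_, trivial⟩
      have := l.hasFDerivAt.comp_hasDerivAt t (aux_exp_deriv B x t)
      rw [hl] at this
      exact this
    · intro t
      refine ⟨?_, trivial⟩
      have h1 : HasDerivAt (fun s : ℝ => (s : ℂ) * μ) (1 * μ) t :=
        (Complex.ofRealCLM.hasDerivAt (x := t)).mul_const μ
      have h2 := (h1.cexp).mul_const (l x)
      have h3 : Complex.exp (t * μ) * (1 * μ) * l x = μ * (Complex.exp (t * μ) * l x) := by ring
      rw [h3] at h2
      exact h2
    · simp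
  exact congrFun key t

theorem aux_decay {V : Type*} [NormedAddCommGroup V] [NormedSpace ℝ V] [FiniteDimensional ℝ V]
    (B : V →L[ℝ] V)
    (hB : ∀ (l : V →L[ℝ] ℂ) (μ : ℂ), l ≠ 0 → (∀ x, l (B x) = μ * l x) → μ.re < 0) :
    ∃ n : ℕ, 1 ≤ n ∧ ∀ x, ‖NormedSpace.exp ((n : ℝ) • B) x‖ ≤ 1 / 4 * ‖x‖ := by
  rcases subsingleton_or_nontrivial V with hV | hV
  · exact ⟨1, le_rfl, fun x => by simp [Subsingleton.elim _ (0 : V)]⟩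
  have : CompleteSpace V := FiniteDimensional.complete ℝ V
  have : FiniteDimensional ℝ (V →L[ℝ] ℂ) := inferInstance
  have : FiniteDimensional ℂ (V →L[ℝ] ℂ) := FiniteDimensional.right ℝ ℂ _
  have : CompleteSpace (V →L[ℝ] ℂ) := inferInstance
  have : Nontrivial (V →L[ℝ] ℂ) := by
    obtain ⟨x, hx⟩ := exists_ne (0 : V)
    obtain ⟨g, -, hg⟩ := exists_dual_vector'' ℝ x
    refine ⟨⟨Complex.ofRealCLM.comp g, 0, fun h => ?_⟩⟩
    have := congrArg (fun f : V →L[ℝ] ℂ => f x) h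
    simp [hg, hx] at this
  let pre : (V →L[ℝ] V) → Module.End ℂ (V →L[ℝ] ℂ) := fun S =>
    { toFun := fun l => l.comp S
      map_add' := fun _ _ => rfl
      map_smul' := fun _ _ => rfl }
  let S := NormedSpace.exp B
  let P : (V →L[ℝ] ℂ) →L[ℂ] (V →L[ℝ] ℂ) := LinearMap.toContinuousLinearMap (pre S)
  have hS : S = NormedSpace.exp ((1 : ℝ) • B) := by simp [S]
  have hcomm : Commute B S := by
    let : NormedAlgebra ℚ (V →L[ℝ] V) := .restrictScalars ℚ ℝ _
    exact (Commute.refl B).exp_right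
  have hspec : ∀ z ∈ spectrum ℂ P, ‖z‖₊ < 1 := by
    intro z hz
    have hz' : z ∈ spectrum ℂ (pre S) := by
      rw [spectrum.mem_iff] at hz ⊢
      intro hu
      apply hz
      have := hu.map (Module.End.toContinuousLinearMap (𝕜 := ℂ) (V →L[ℝ] ℂ))
      rw [map_sub, AlgEquiv.commutes] at this
      exact this
    have hev := Module.End.HasEigenvalue.of_mem_spectrum hz'
    have hmaps : ∀ l ∈ Module.End.eigenspace (pre S) z, pre B l ∈ Module.End.eigenspace (pre S) z := by
      intro l hl
      rw [Module.End.mem_eigenspace_iff] at hl ⊢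
      ext x
      have h1 := congrArg (fun f : V →L[ℝ] ℂ => f (B x)) hl
      have h2 := congrArg (fun f : V →L[ℝ] V => f x) hcomm.eq
      simp only [mul_apply_eq_comp] at h2
      change l (S (B x)) = z * l (B x) at h1
      change l (B (S x)) = z * l (B x)
      rw [h2, h1]
    have : Nontrivial (Module.End.eigenspace (pre S) z) :=
      Submodule.nontrivial_iff_ne_bot.mpr hev
    obtain ⟨μ, hμ⟩ := Module.End.exists_eigenvalue (K := ℂ) (V := Module.End.eigenspace (pre S) z)
      ((pre B).restrict hmaps)
    obtain ⟨l, hl⟩ := hμ.exists_hasEigenvector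
    have hl1 := hl.apply_eq_smul
    have hlne : (l : V →L[ℝ] ℂ) ≠ 0 := fun h => hl.2 (Subtype.ext h)
    have hlB : ∀ x, (l : V →L[ℝ] ℂ) (B x) = μ * (l : V →L[ℝ] ℂ) x := fun x =>
      congrArg (fun f : Module.End.eigenspace (pre S) z => (f : V →L[ℝ] ℂ) x) hl1
    have hlS : ∀ x, (l : V →L[ℝ] ℂ) (S x) = z * (l : V →L[ℝ] ℂ) x := fun x =>
      congrArg (fun f : V →L[ℝ] ℂ => f x) (Module.End.mem_eigenspace_iff.mp l.2)
    obtain ⟨x, hx⟩ : ∃ x, (l : V →L[ℝ] ℂ) x ≠ 0 := by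
      by_contra! h
      exact hlne (ContinuousLinearMap.ext h)
    have h3 := aux_eig B l μ hlB x 1
    rw [← hS, hlS] at h3
    have h4 := mul_right_cancel₀ hx h3
    have h5 := hB l μ hlne hlB
    rw [← NNReal.coe_lt_coe, coe_nnnorm, h4, Complex.norm_exp]
    simpa using h5
  have hrad : spectralRadius ℂ P < (1 : NNReal) := spectrum.spectralRadius_lt_of_forall_lt P hspec
  obtain ⟨q, hq1, hq2⟩ := ENNReal.lt_iff_exists_nnreal_btwn.mp hrad
  have hq3 : q < 1 := by exact_mod_cast hq2
  have hG := spectrum.pow_nnnorm_pow_one_div_tendsto_nhds_spectralRadius P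
  have e1 := hG.eventually (gt_mem_nhds hq1)
  have e2 : ∀ᶠ n : ℕ in atTop, (q : ℝ) ^ n < 1 / 4 :=
    (tendsto_pow_atTop_nhds_zero_of_lt_one q.2 (by exact_mod_cast hq3)).eventually
      (gt_mem_nhds (by norm_num))
  obtain ⟨n, hn1, hn2, hn3⟩ := (e1.and (e2.and (eventually_ge_atTop 1))).exists
  refine ⟨n, hn3, fun x => ?_⟩
  have hPn : ‖P ^ n‖ ≤ 1 / 4 := by
    have h6 : (‖P ^ n‖₊ : ENNReal) ≤ (q : ENNReal) ^ n := by
      have h7 := ENNReal.rpow_le_rpow hn1.le (Nat.cast_nonneg n : (0 : ℝ) ≤ n)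
      rw [← ENNReal.rpow_mul, one_div, inv_mul_cancel₀ (by positivity), ENNReal.rpow_one,
        ENNReal.rpow_natCast] at h7
      exact h7
    have h8 : ‖P ^ n‖₊ ≤ q ^ n := by exact_mod_cast h6
    have h9 : ‖P ^ n‖ ≤ (q : ℝ) ^ n := by exact_mod_cast h8
    linarith
  have hSn : NormedSpace.exp ((n : ℝ) • B) = S ^ n := by
    let : NormedAlgebra ℚ (V →L[ℝ] V) := .restrictScalars ℚ ℝ _
    rw [Nat.cast_smul_eq_nsmul, NormedSpace.exp_nsmul]
  have hPS : ∀ (k : ℕ) (l : V →L[ℝ] ℂ), (P ^ k) l = l.comp (S ^ k) := by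
    intro k
    induction k with
    | zero => intro l; rfl
    | succ k ih =>
      intro l
      rw [pow_succ, mul_apply_eq_comp, ih, pow_succ']
      rfl
  rw [hSn]
  obtain ⟨g, hg1, hg2⟩ := exists_dual_vector'' ℝ ((S ^ n) x)
  let l : V →L[ℝ] ℂ := Complex.ofRealCLM.comp g
  have hl : ‖l‖ ≤ 1 := by
    refine (ContinuousLinearMap.opNorm_comp_le _ _).trans ?_
    simpa using hg1
  have h10 : ((P ^ n) l) x = ((‖(S ^ n) x‖ : ℝ) : ℂ) := by
    rw [hPS]
    change ((g ((S ^ n) x) : ℝ) : ℂ) = _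
    rw [hg2]; rfl
  calc ‖(S ^ n) x‖ = ‖((P ^ n) l) x‖ := by rw [h10]; simp
    _ ≤ ‖(P ^ n) l‖ * ‖x‖ := ContinuousLinearMap.le_opNorm _ _
    _ ≤ (‖P ^ n‖ * ‖l‖) * ‖x‖ := by gcongr; exact ContinuousLinearMap.le_opNorm _ _
    _ ≤ (1 / 4 * 1) * ‖x‖ := by gcongr
    _ = _ := by ring

theorem aux_dist {V : Type*} [NormedAddCommGroup V] [NormedSpace ℝ V]
    (F : V → V) (L : NNReal) (hL : LipschitzWith L F) (f g : ℝ → V)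
    (hf : ∀ t, 0 ≤ t → HasDerivAt f (F (f t)) t) (hg : ∀ t, 0 ≤ t → HasDerivAt g (F (g t)) t)
    (t : ℝ) (ht : 0 ≤ t) : dist (f t) (g t) ≤ dist (f 0) (g 0) * Real.exp (L * t) := by
  have := dist_le_of_trajectories_ODE (v := fun _ => F) (K := L) (f := f) (g := g) (a := 0) (b := t)
    (δ := dist (f 0) (g 0)) (fun _ => hL)
    (fun s hs => (hf s hs.1).continuousAt.continuousWithinAt)
    (fun s hs => (hf s hs.1).hasDerivWithinAt)
    (fun s hs => (hg s hs.1).continuousAt.continuousWithinAt)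
    (fun s hs => (hg s hs.1).hasDerivWithinAt) le_rfl t ⟨ht, le_rfl⟩
  simpa using this

theorem aux_discrete {V : Type*} [NormedAddCommGroup V] [ProperSpace V]
    (f : V → V) (hf : Continuous f) (Λ : ℝ) (hΛ : 1 ≤ Λ) (hgrow : ∀ x, ‖f x‖ ≤ Λ * ‖x‖)
    (δ R : ℝ) (hδ : 0 < δ) (hnear : ∀ x, ‖x‖ ≤ δ → ‖f x‖ ≤ 1 / 2 * ‖x‖)
    (hfar : ∀ x, R ≤ ‖x‖ → ‖f x‖ ≤ 1 / 2 * ‖x‖)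
    (hatt : ∀ x, Tendsto (fun k : ℕ => f^[k] x) atTop (nhds 0)) :
    ∃ C : ℝ, 1 ≤ C ∧ ∀ (k : ℕ) x, ‖f^[k] x‖ ≤ C * (1 / 2) ^ k * ‖x‖ := by
  have hmono : Monotone (fun n : ℕ => {x : V | ‖f^[n] x‖ < δ}) := by
    refine monotone_nat_of_le_succ fun n x hx => ?_
    simp only [Set.mem_ofPred_eq, Function.iterate_succ_apply'] at hx ⊢
    have := hnear _ hx.le
    have := norm_nonneg (f^[n] x)
    linarith
  obtain ⟨n₀, hn₀⟩ := (isCompact_closedBall (0 : V) R).elim_directed_cover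
    (fun n : ℕ => {x : V | ‖f^[n] x‖ < δ})
    (fun n => isOpen_lt (hf.iterate n).norm continuous_const)
    (fun x _ => by
      have := (hatt x).norm.eventually (gt_mem_nhds (by simpa using hδ))
      obtain ⟨n, hn⟩ := this.exists
      exact Set.mem_iUnion.mpr ⟨n, hn⟩) hmono.directed_le
  have hiter : ∀ (k : ℕ) x, ‖f^[k] x‖ ≤ Λ ^ k * ‖x‖ := by
    intro k x
    induction k with
    | zero => simp
    | succ k ih =>
      rw [Function.iterate_succ_apply', pow_succ']
      calc _ ≤ Λ * ‖f^[k] x‖ := hgrow _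
        _ ≤ Λ * (Λ ^ k * ‖x‖) := by gcongr
        _ = _ := by ring
  have hiter2 : ∀ (k : ℕ) x, ‖x‖ ≤ δ → ‖f^[k] x‖ ≤ (1 / 2) ^ k * ‖x‖ := by
    intro k
    induction k with
    | zero => intro x _; simp
    | succ k ih =>
      intro x hx
      rw [Function.iterate_succ_apply]
      have h1 := hnear x hx
      have h2 := ih (f x) (by linarith [norm_nonneg x])
      calc _ ≤ (1 / 2) ^ k * ‖f x‖ := h2
        _ ≤ (1 / 2) ^ k * (1 / 2 * ‖x‖) := by gcongr
        _ = _ := by ring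
  have hC1 : (1 : ℝ) ≤ (2 * Λ) ^ n₀ := one_le_pow₀ (by linarith)
  refine ⟨(2 * Λ) ^ n₀, hC1, ?_⟩
  have hball : ∀ (k : ℕ) x, ‖x‖ ≤ R → ‖f^[k] x‖ ≤ (2 * Λ) ^ n₀ * (1 / 2) ^ k * ‖x‖ := by
    intro k x hx
    rcases le_total k n₀ with hk | hk
    · calc _ ≤ Λ ^ k * ‖x‖ := hiter k x
        _ = (2 * Λ) ^ k * (1 / 2) ^ k * ‖x‖ := by
          rw [← mul_pow]; congr 2; ring
        _ ≤ _ := by gcongr; linarith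
    · obtain ⟨j, rfl⟩ := Nat.exists_eq_add_of_le hk
      have h1 : ‖f^[n₀] x‖ < δ := hn₀ (by simpa using hx)
      rw [add_comm, Function.iterate_add_apply]
      calc _ ≤ (1 / 2) ^ j * ‖f^[n₀] x‖ := hiter2 j _ h1.le
        _ ≤ (1 / 2) ^ j * (Λ ^ n₀ * ‖x‖) := by gcongr; exact hiter _ _
        _ = (2 * Λ) ^ n₀ * (1 / 2) ^ (j + n₀) * ‖x‖ := by
          rw [pow_add, mul_pow]
          have : (2 : ℝ) ^ n₀ * (1 / 2) ^ n₀ = 1 := by rw [← mul_pow]; norm_num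
          linear_combination (-(1 / 2) ^ j * Λ ^ n₀ * ‖x‖) * this
  intro k
  induction k with
  | zero =>
    intro x
    have := mul_le_mul_of_nonneg_right hC1 (norm_nonneg x)
    simpa using this
  | succ k ih =>
    intro x
    rcases le_total ‖x‖ R with hx | hx
    · exact hball _ x hx
    · rw [Function.iterate_succ_apply]
      calc _ ≤ (2 * Λ) ^ n₀ * (1 / 2) ^ k * ‖f x‖ := ih _
        _ ≤ (2 * Λ) ^ n₀ * (1 / 2) ^ k * (1 / 2 * ‖x‖) := by gcongr; exact hfar x hx
        _ = _ := by ring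

theorem aux_core {V : Type*} [NormedAddCommGroup V] [NormedSpace ℝ V] [FiniteDimensional ℝ V]
    (F : V → V) (L : NNReal) (hL : LipschitzWith L F) (h0 : F 0 = 0)
    (B : V →L[ℝ] V) (hB : HasFDerivAt F B 0) (K : Set V) (hK : IsCompact K)
    (hlin : ∀ z ∉ K, F z = B z) (M : ℝ) (hM : ∀ z, ‖F z - B z‖ ≤ M)
    (u : ℝ → V → V) (hu0 : ∀ x, u 0 x = x)
    (huf : ∀ x t, HasDerivAt (fun s => u s x) (F (u t x)) t)
    (hatt : ∀ x, Tendsto (fun t => u t x) atTop (nhds 0)) :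
    ∃ C > (0:ℝ), ∃ c > (0:ℝ), ∀ x, ∀ t : ℝ, 0 ≤ t →
      ‖u t x‖ ≤ C * Real.exp (-c * t) * ‖x‖ := by
  have : ProperSpace V := FiniteDimensional.proper ℝ V
  -- eigenvalues
  have heig : ∀ (l : V →L[ℝ] ℂ) (μ : ℂ), l ≠ 0 → (∀ x, l (B x) = μ * l x) → μ.re < 0 := by
    intro l μ hl hlB
    by_contra! hμ
    obtain ⟨x₀, hx₀⟩ : ∃ x, l x ≠ 0 := by
      by_contra! h
      exact hl (ContinuousLinearMap.ext h)
    obtain ⟨c, hc⟩ := hK.exists_bound_of_continuousOn l.continuous.continuousOn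
    let r : ℝ := (|c| + 1) / ‖l x₀‖
    have hx0 : 0 < ‖l x₀‖ := norm_pos_iff.mpr hx₀
    have hr : ‖l (r • x₀)‖ = |c| + 1 := by
      rw [map_smul, norm_smul, Real.norm_of_nonneg (by positivity)]
      exact div_mul_cancel₀ _ hx0.ne'
    have hge : ∀ t : ℝ, 0 ≤ t → |c| + 1 ≤ ‖l (NormedSpace.exp (t • B) (r • x₀))‖ := by
      intro t ht
      rw [aux_eig B l μ hlB, norm_mul, hr, Complex.norm_exp]
      have : 1 ≤ Real.exp ((t : ℂ) * μ).re := by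
        rw [Real.one_le_exp_iff]
        simpa using mul_nonneg ht hμ
      nlinarith [abs_nonneg c]
    have hu : ∀ t : ℝ, 0 ≤ t → u t (r • x₀) = NormedSpace.exp (t • B) (r • x₀) := by
      intro t ht
      have h := aux_dist F L hL (fun t => u t (r • x₀))
        (fun t : ℝ => NormedSpace.exp (t • B) (r • x₀)) (fun s _ => huf _ s)
        (fun s hs => by
          have hnK : NormedSpace.exp (s • B) (r • x₀) ∉ K := fun hmem => by
            have h1 := hc _ hmem
            have h2 := hge s hs
            linarith [le_abs_self c]
          rw [hlin _ hnK]
          exact aux_exp_deriv B _ s) t ht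
      simp only [hu0, zero_smul, NormedSpace.exp_zero, one_apply_eq_self,
        dist_self, zero_mul] at h
      exact dist_le_zero.mp h
    have hlim := ((l.continuous.tendsto 0).comp (hatt (r • x₀))).norm
    have := ge_of_tendsto hlim ((eventually_ge_atTop 0).mono fun t ht => by
      have := hge t ht
      rw [← hu t ht] at this
      exact this)
    simp at this
    linarith [abs_nonneg c]
  obtain ⟨n, hn, hdec⟩ := aux_decay B heig
  obtain ⟨T, hT⟩ : ∃ T : ℝ, T = n := ⟨_, rfl⟩
  rw [← hT] at hdec
  have hTpos : 0 < T := by rw [hT]; exact_mod_cast hn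
  have hdist : ∀ t x y, 0 ≤ t → dist (u t x) (u t y) ≤ dist x y * Real.exp (L * t) := by
    intro t x y ht
    have := aux_dist F L hL (fun t => u t x) (fun t => u t y) (fun s _ => huf _ s)
      (fun s _ => huf _ s) t ht
    simpa [hu0] using this
  have hsemi : ∀ t s x, 0 ≤ t → u (t + s) x = u t (u s x) := by
    intro t s x ht
    have h := aux_dist F L hL (fun t => u (t + s) x) (fun t => u t (u s x))
      (fun r _ => (huf x (r + s)).comp_add_const r s) (fun r _ => huf _ r) t ht
    simp only [hu0, zero_add, dist_self, zero_mul] at h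
    exact dist_le_zero.mp h
  set Λ : ℝ := Real.exp (L * T) with hΛdef
  have hΛ1 : 1 ≤ Λ := Real.one_le_exp (by positivity)
  have hgrow : ∀ t x, 0 ≤ t → t ≤ T → ‖u t x‖ ≤ Λ * ‖x‖ := by
    intro t x ht htT
    have h := aux_dist F L hL (fun t => u t x) (fun _ => 0) (fun s _ => huf _ s)
      (fun s _ => by rw [h0]; exact hasDerivAt_const s 0) t ht
    simp only [hu0, dist_zero_right] at h
    calc _ ≤ ‖x‖ * Real.exp (L * t) := h
      _ ≤ ‖x‖ * Real.exp (L * T) := by gcongr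
      _ = _ := mul_comm _ _
  let k : NNReal := ‖B‖₊ + 1
  have hkpos : (0 : ℝ) < k := by positivity
  have hBlip : LipschitzWith k B := B.lipschitz.weaken (by simp [k])
  obtain ⟨D, hD⟩ : ∃ D : ℝ, D = (Real.exp (k * T) - 1) / k := ⟨_, rfl⟩
  have hDpos : 0 < D := by
    rw [hD]
    refine div_pos ?_ hkpos
    linarith [Real.one_lt_exp_iff.mpr (mul_pos hkpos hTpos)]
  have hcomp : ∀ ε x, (∀ s, 0 ≤ s → s ≤ T → ‖F (u s x) - B (u s x)‖ ≤ ε) →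
      ‖u T x‖ ≤ 1 / 4 * ‖x‖ + ε * D := by
    intro ε x hε
    have h := dist_le_of_approx_trajectories_ODE (v := fun _ => B) (K := k)
      (f := fun t => u t x) (f' := fun t => F (u t x))
      (g := fun t : ℝ => NormedSpace.exp (t • B) x)
      (g' := fun t => B (NormedSpace.exp (t • B) x)) (a := 0) (b := T)
      (δ := 0) (εf := ε) (εg := 0) (fun _ => hBlip)
      (fun s _ => (huf x s).continuousAt.continuousWithinAt)
      (fun s _ => (huf x s).hasDerivWithinAt)
      (fun s hs => by rw [dist_eq_norm]; exact hε s hs.1 hs.2.le)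
      (fun s _ => (aux_exp_deriv B x s).continuousAt.continuousWithinAt)
      (fun s _ => (aux_exp_deriv B x s).hasDerivWithinAt)
      (fun s _ => by simp)
      (by simp [hu0]) T ⟨hTpos.le, le_rfl⟩
    rw [gronwallBound_of_K_ne_0 hkpos.ne'] at h
    simp only [add_zero, sub_zero, zero_mul, zero_add] at h
    have h2 : ε / k * (Real.exp (k * T) - 1) = ε * D := by rw [hD]; ring
    rw [h2, dist_eq_norm] at h
    have h3 := hdec x
    have h4 := norm_le_norm_sub_add (u T x) (NormedSpace.exp (T • B) x)
    linarith
  have hM0 : 0 ≤ M := (norm_nonneg _).trans (hM 0)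
  have hfar : ∀ x, 4 * M * D ≤ ‖x‖ → ‖u T x‖ ≤ 1 / 2 * ‖x‖ := by
    intro x hx
    have := hcomp M x (fun s _ _ => hM _)
    linarith
  obtain ⟨δ, hδ, hnear⟩ : ∃ δ > 0, ∀ x, ‖x‖ ≤ δ → ‖u T x‖ ≤ 1 / 2 * ‖x‖ := by
    have hη : 0 < 1 / (4 * Λ * D) := by positivity
    have hlo := hB.isLittleO.def hη
    obtain ⟨δ₀, hδ₀, hball⟩ := Metric.eventually_nhds_iff.mp hlo
    refine ⟨δ₀ / (2 * Λ), by positivity, fun x hx => ?_⟩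
    have hx' : Λ * ‖x‖ < δ₀ := by
      rw [le_div_iff₀ (by positivity)] at hx
      nlinarith [norm_nonneg x]
    have := hcomp (1 / (4 * Λ * D) * (Λ * ‖x‖)) x (fun s hs hsT => by
      have h1 := hgrow s x hs hsT
      have h2 := hball (y := u s x) (by rw [dist_zero_right]; linarith)
      simp only [h0, sub_zero] at h2
      refine h2.trans ?_
      gcongr)
    have h5 : 1 / (4 * Λ * D) * (Λ * ‖x‖) * D = 1 / 4 * ‖x‖ := by
      field_simp
    rw [h5] at this
    linarith
  have hiter : ∀ (j : ℕ) x, (u T)^[j] x = u (j * T) x := by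
    intro j x
    induction j with
    | zero => simp [hu0]
    | succ j ih =>
      rw [Function.iterate_succ_apply', ih, ← hsemi T _ x hTpos.le]
      congr 1; push_cast; ring
  have hcont : Continuous (u T) := by
    have : LipschitzWith ⟨Λ, by positivity⟩ (u T) := LipschitzWith.of_dist_le_mul fun x y => by
      have := hdist T x y hTpos.le
      rw [mul_comm] at this
      exact this
    exact this.continuous
  obtain ⟨C, hC1, hC⟩ := aux_discrete (u T) hcont Λ hΛ1 (fun x => hgrow T x hTpos.le le_rfl)
    δ (4 * M * D) hδ hnear hfar (fun x => by
      simp only [hiter]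
      exact (hatt x).comp (tendsto_natCast_atTop_atTop.atTop_mul_const hTpos))
  have hlog : 0 < Real.log 2 := Real.log_pos (by norm_num)
  refine ⟨Λ * C * 2, by positivity, Real.log 2 / T, by positivity, fun x t ht => ?_⟩
  have hj1 := Nat.floor_le (div_nonneg ht hTpos.le)
  have hj2 := Nat.lt_floor_add_one (t / T)
  set j := ⌊t / T⌋₊
  rw [le_div_iff₀ hTpos] at hj1
  have hj3 : t < (j + 1) * T := by rwa [div_lt_iff₀ hTpos] at hj2
  have hsplit : u t x = u (t - j * T) (u (j * T) x) := by
    rw [← hsemi _ _ _ (by linarith)]; congr 1; ring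
  have hpow : ((1 : ℝ) / 2) ^ j ≤ 2 * Real.exp (-(Real.log 2 / T) * t) := by
    have e1 : ((1 : ℝ) / 2) ^ j = Real.exp (-(j * Real.log 2)) := by
      rw [Real.exp_neg, Real.exp_nat_mul, Real.exp_log (by norm_num)]
      simp
    have e2 : 2 * Real.exp (-(Real.log 2 / T) * t)
        = Real.exp (Real.log 2 + -(Real.log 2 / T) * t) := by
      rw [Real.exp_add, Real.exp_log (by norm_num)]
    rw [e1, e2, Real.exp_le_exp]
    have : -(Real.log 2 / T) * t = -(Real.log 2 * (t / T)) := by ring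
    rw [this]
    nlinarith
  rw [hsplit]
  calc _ ≤ Λ * ‖u (j * T) x‖ := hgrow _ _ (by linarith) (by linarith)
    _ ≤ Λ * (C * (1 / 2) ^ j * ‖x‖) := by
      gcongr
      rw [← hiter]; exact hC j x
    _ ≤ Λ * (C * (2 * Real.exp (-(Real.log 2 / T) * t)) * ‖x‖) := by gcongr
    _ = _ := by ring

/-- **Exponential contraction on the stable subspace.**
If `X₀` is a smooth vector field on `ℝ^N` vanishing at `0`, agreeing outside a compact set
with its linearization `A = DX₀(0)` which has no purely imaginary complex eigenvalue, `U₀`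
is its complete flow, and `E` is an `X₀`-invariant linear subspace on which `U₀(t)x → 0`
as `t → ∞`, then `‖U₀(t)x‖ ≤ C e^{-ct}‖x‖` for all `x ∈ E`, `t ≥ 0`. -/
theorem exponential_contraction_on_stable_subspace {N : ℕ}
    (X₀ : EuclideanSpace ℝ (Fin N) → EuclideanSpace ℝ (Fin N))
    (hX₀smooth : ContDiff ℝ (⊤ : ℕ∞) X₀)
    (hX₀zero : X₀ 0 = 0)
    (A : EuclideanSpace ℝ (Fin N) →L[ℝ] EuclideanSpace ℝ (Fin N))
    (hA : HasFDerivAt X₀ A 0)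
    (K : Set (EuclideanSpace ℝ (Fin N))) (hK : IsCompact K)
    (hlin : ∀ z ∉ K, X₀ z = A z)
    (hspec : ∀ μ : ℂ, μ.re = 0 →
      ¬ Module.End.HasEigenvalue
          (LinearMap.baseChange ℂ (A : EuclideanSpace ℝ (Fin N) →ₗ[ℝ] EuclideanSpace ℝ (Fin N))) μ)
    (U₀ : ℝ → EuclideanSpace ℝ (Fin N) → EuclideanSpace ℝ (Fin N))
    (hU₀0 : ∀ x, U₀ 0 x = x)
    (hU₀flow : ∀ x t, HasDerivAt (fun s => U₀ s x) (X₀ (U₀ t x)) t)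
    (E : Submodule ℝ (EuclideanSpace ℝ (Fin N)))
    (hEinv : ∀ x ∈ E, X₀ x ∈ E)
    (hEattract : ∀ x ∈ E, Tendsto (fun t => U₀ t x) atTop (nhds 0)) :
    ∃ C > (0:ℝ), ∃ c > (0:ℝ), ∀ x ∈ E, ∀ t : ℝ, 0 ≤ t →
      ‖U₀ t x‖ ≤ C * Real.exp (-c * t) * ‖x‖ := by
  have hGc : HasCompactSupport (fun z => X₀ z - A z) :=
    HasCompactSupport.intro hK fun z hz => by simp [hlin z hz]
  have hGs : ContDiff ℝ 1 (fun z => X₀ z - A z) :=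
    (hX₀smooth.of_le (by exact_mod_cast le_top)).sub A.contDiff
  obtain ⟨M, hM⟩ := hGs.continuous.bounded_above_of_compact_support hGc
  obtain ⟨L₁, hL₁⟩ := ContDiff.lipschitzWith_of_hasCompactSupport hGc hGs (by simp)
  obtain ⟨L, hL⟩ : ∃ L, LipschitzWith L X₀ := by
    refine ⟨L₁ + ‖A‖₊, ?_⟩
    have := hL₁.add A.lipschitz
    simpa using this
  let P := E.orthogonalProjectionOnto
  let J := E.subtypeL
  have hPJ : ∀ x ∈ E, J (P x) = x := fun x hx => by
    exact Submodule.starProjection_eq_self_iff.mpr hx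
  have hinv : ∀ x ∈ E, ∀ t, J (P (U₀ t x)) = U₀ t x := by
    intro x hx
    let Q : EuclideanSpace ℝ (Fin N) →L[ℝ] EuclideanSpace ℝ (Fin N) :=
      ContinuousLinearMap.id ℝ _ - J.comp P
    have hQE : ∀ y ∈ E, Q y = 0 := fun y hy => by
      simp only [Q, sub_apply, ContinuousLinearMap.id_apply,
        ContinuousLinearMap.comp_apply, hPJ y hy, sub_self]
    have hdecomp : ∀ y, J (P y) + Q y = y := fun y => by
      simp [Q]
    have hJmem : ∀ y, J y ∈ E := fun y => y.2
    have key : (fun t => Q (U₀ t x)) = fun _ => 0 := by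
      refine ODE_solution_unique_univ (v := fun t y => Q (X₀ (J (P (U₀ t x)) + y)))
        (s := fun _ => Set.univ) (K := ‖Q‖₊ * (L * 1)) (t₀ := 0) ?_ ?_ ?_ ?_
      · intro t
        refine LipschitzWith.lipschitzOnWith ?_
        refine Q.lipschitz.comp (hL.comp ?_)
        exact LipschitzWith.of_dist_le_mul fun a b => by simp
      · intro t
        refine ⟨?_, trivial⟩
        simp only [hdecomp]
        exact Q.hasFDerivAt.comp_hasDerivAt t (hU₀flow x t)
      · intro t
        refine ⟨?_, trivial⟩
        simp only [add_zero]
        rw [hQE _ (hEinv _ (hJmem _))]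
        exact hasDerivAt_const t 0
      · simp only [hU₀0]
        exact hQE x hx
    intro t
    have h1 : Q (U₀ t x) = 0 := congrFun key t
    have h2 := hdecomp (U₀ t x)
    rw [h1, add_zero] at h2
    exact h2
  have hPnorm : ∀ y, ‖P y‖ = ‖J (P y)‖ := fun y => rfl
  obtain ⟨C, hC, c, hc, hfin⟩ := aux_core (V := E) (fun y => P (X₀ (J y)))
    (‖P‖₊ * (L * ‖J‖₊)) (P.lipschitz.comp (hL.comp J.lipschitz)) (by simp [hX₀zero])
    (P.comp (A.comp J))
    (by
      have hA' : HasFDerivAt X₀ A (J 0) := by simpa using hA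
      exact P.hasFDerivAt.comp (0 : E) (hA'.comp (0 : E) J.hasFDerivAt))
    (J ⁻¹' K) (E.closed_of_finiteDimensional.isClosedEmbedding_subtypeVal.isCompact_preimage hK)
    (fun z hz => by
      have : X₀ (J z) = A (J z) := hlin _ hz
      simp [this])
    (‖P‖ * M) (fun z => by
      have : P (X₀ (J z)) - (P.comp (A.comp J)) z = P (X₀ (J z) - A (J z)) := by simp
      rw [this]
      exact (P.le_opNorm _).trans (by gcongr; exact hM _))
    (fun t x => P (U₀ t (J x)))
    (fun x => by
      rw [hU₀0]
      exact Subtype.ext (hPJ _ x.2))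
    (fun x t => by
      rw [hinv (J x) x.2 t]
      exact P.hasFDerivAt.comp_hasDerivAt t (hU₀flow (J x) t))
    (fun x => by
      have := (P.continuous.tendsto 0).comp (hEattract (J x) x.2)
      rw [map_zero] at this
      exact this)
  refine ⟨C, hC, c, hc, fun x hx t ht => ?_⟩
  have h := hfin ⟨x, hx⟩ t ht
  rw [hPnorm, hinv (J ⟨x, hx⟩) hx t] at h
  exact h
end

section
/- The set of σ ∈ (v,∞) that are Hessian thresholds or effectively resonant is discrete in (v,∞); that is, every compact subinterval of (v,∞) contains only finitely many such σ. -/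
open Finset

/-- The exponent `r_j(σ) = 1/2 - √(1/4 - a/(σ - v))` associated to a Hessian eigenvalue
`a` at a critical point with critical value `v`, at energy `σ`. -/
noncomputable def rExp (v a σ : ℝ) : ℝ :=
  1 / 2 - Real.sqrt (1 / 4 - a / (σ - v))

theorem aux_rolle (D : Set ℝ) (hD : D.OrdConnected) (f f' : ℝ → ℝ)
    (hf : ∀ x ∈ D, HasDerivAt f (f' x) x)
    (hfin : {x | x ∈ D ∧ f' x = 0}.Finite) : {x | x ∈ D ∧ f x = 0}.Finite := by
  classical
  set Z' := {x | x ∈ D ∧ f' x = 0} with hZ'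
  have key : ∀ x y, x ∈ D → f x = 0 → y ∈ D → f y = 0 → x < y →
      ∃ z ∈ Z', x < z ∧ z < y := by
    intro x y hx hfx hy hfy hxy
    have hsub : Set.Icc x y ⊆ D := hD.out hx hy
    obtain ⟨z, hz, hz0⟩ := exists_hasDerivAt_eq_zero (f := f) (f' := f') hxy
      (fun t ht => (hf t (hsub ht)).continuousAt.continuousWithinAt) (by rw [hfx, hfy])
      (fun t ht => hf t (hsub ⟨ht.1.le, ht.2.le⟩))
    exact ⟨z, ⟨hsub ⟨hz.1.le, hz.2.le⟩, hz0⟩, hz.1, hz.2⟩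
  refine Set.Finite.of_finite_image (f := fun z => {t | t ∈ Z' ∧ t < z}) ?_ ?_
  · refine hfin.finite_subsets.subset ?_
    rintro _ ⟨z, _, rfl⟩
    exact fun t ht => ht.1
  · intro x hx y hy hxy
    simp only at hxy
    rcases lt_trichotomy x y with h | h | h
    · obtain ⟨z, hz, h1, h2⟩ := key x y hx.1 hx.2 hy.1 hy.2 h
      have : z ∈ {t | t ∈ Z' ∧ t < x} := by rw [hxy]; exact ⟨hz, h2⟩
      exact absurd this.2 (not_lt.mpr h1.le)
    · exact h
    · obtain ⟨z, hz, h1, h2⟩ := key y x hy.1 hy.2 hx.1 hx.2 h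
      have : z ∈ {t | t ∈ Z' ∧ t < y} := by rw [← hxy]; exact ⟨hz, h2⟩
      exact absurd this.2 (not_lt.mpr h1.le)

theorem aux_ordc (T : Finset ℝ) : {x : ℝ | ∀ b ∈ T, 0 < 1 / 4 - b * x}.OrdConnected := by
  refine ⟨fun x hx y hy z hz b hb => ?_⟩
  have h1 := hx b hb
  have h2 := hy b hb
  rcases le_total 0 b with h | h
  · nlinarith [mul_le_mul_of_nonneg_left hz.2 h]
  · nlinarith [mul_le_mul_of_nonpos_left hz.1 h]

theorem aux_deriv (b p x : ℝ) (h : 0 < 1 / 4 - b * x) :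
    HasDerivAt (fun x => (1 / 4 - b * x) ^ p) (-b * p * (1 / 4 - b * x) ^ (p - 1)) x := by
  have h1 : HasDerivAt (fun x => 1 / 4 - b * x) (-b) x := by
    have h2 := ((hasDerivAt_id x).const_mul b).const_sub (1 / 4)
    rw [mul_one] at h2
    exact h2
  exact h1.rpow_const (Or.inl h.ne')

theorem aux_pow (T : Finset ℝ) : ∀ p : ℝ, (∀ k : ℕ, p ≠ k) → ∀ w : ℝ → ℝ, (∃ b ∈ T, w b ≠ 0) →
    {x : ℝ | x ∈ {x : ℝ | ∀ b ∈ T, 0 < 1 / 4 - b * x} ∧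
      ∑ b ∈ T, w b * (1 / 4 - b * x) ^ p = 0}.Finite := by
  classical
  induction T using Finset.induction_on with
  | empty => rintro p hp w ⟨b, hb, _⟩; simp at hb
  | insert b₀ T hb₀ ih =>
    intro p hp w hw
    by_cases hT : ∃ b ∈ T, w b ≠ 0
    · have ih' := ih (p - 1) (fun k hk => hp (k + 1) (by push_cast; linarith))
        (fun b => w b * (b₀ - b)) (by
          obtain ⟨b, hb, hwb⟩ := hT
          refine ⟨b, hb, mul_ne_zero hwb (sub_ne_zero.mpr ?_)⟩
          rintro rfl; exact hb₀ hb)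
      have hp0 : p ≠ 0 := by simpa using hp 0
      have hR := aux_rolle {x : ℝ | ∀ b ∈ insert b₀ T, 0 < 1 / 4 - b * x} (aux_ordc _)
        (fun x => (∑ b ∈ insert b₀ T, w b * (1 / 4 - b * x) ^ p) * (1 / 4 - b₀ * x) ^ (-p))
        (fun x => (∑ b ∈ insert b₀ T, w b * (-b * p * (1 / 4 - b * x) ^ (p - 1)))
            * (1 / 4 - b₀ * x) ^ (-p)
          + (∑ b ∈ insert b₀ T, w b * (1 / 4 - b * x) ^ p)
            * (-b₀ * (-p) * (1 / 4 - b₀ * x) ^ (-p - 1)))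
        (fun x hx => by
          refine HasDerivAt.mul ?_ (aux_deriv _ _ _ (hx _ (Finset.mem_insert_self _ _)))
          refine HasDerivAt.fun_sum fun b hb => ?_
          exact (aux_deriv _ _ _ (hx _ hb)).const_mul _)
        (ih'.subset (by
          rintro x ⟨hx, h0⟩
          refine ⟨fun b hb => hx b (Finset.mem_insert_of_mem hb), ?_⟩
          have hx0 : 0 < 1 / 4 - b₀ * x := hx _ (Finset.mem_insert_self _ _)
          have e1 : (1 / 4 - b₀ * x) ^ (-p) = (1 / 4 - b₀ * x) ^ (-p - 1) * (1 / 4 - b₀ * x) := by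
            rw [Real.rpow_sub_one hx0.ne', div_mul_cancel₀ _ hx0.ne']
          have hq : 0 < (1 / 4 - b₀ * x) ^ (-p - 1) := Real.rpow_pos_of_pos hx0 _
          rw [e1] at h0
          have h2 : (1 / 4 - b₀ * x) ^ (-p - 1) * (p / 4) *
              (∑ b ∈ insert b₀ T, w b * (b₀ - b) * (1 / 4 - b * x) ^ (p - 1)) = 0 := by
            rw [← h0, Finset.mul_sum, Finset.sum_mul, Finset.sum_mul, ← Finset.sum_add_distrib]
            refine Finset.sum_congr rfl fun b hb => ?_
            have hxb : 0 < 1 / 4 - b * x := hx _ hb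
            have e2 : (1 / 4 - b * x) ^ p = (1 / 4 - b * x) ^ (p - 1) * (1 / 4 - b * x) := by
              rw [Real.rpow_sub_one hxb.ne', div_mul_cancel₀ _ hxb.ne']
            rw [e2]; ring
          have h3 := (mul_eq_zero.mp h2).resolve_left
            (mul_ne_zero hq.ne' (div_ne_zero hp0 (by norm_num)))
          rw [Finset.sum_insert hb₀] at h3
          simpa using h3))
      refine hR.subset ?_
      rintro x ⟨hx, h0⟩
      exact ⟨hx, by simp only [h0, zero_mul]⟩
    · push Not at hT
      have hw0 : w b₀ ≠ 0 := by
        obtain ⟨b, hb, hwb⟩ := hw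
        rcases Finset.mem_insert.mp hb with rfl | hb
        · exact hwb
        · exact absurd (hT b hb) hwb
      convert Set.finite_empty
      ext x
      simp only [Set.mem_ofPred_eq, Set.mem_empty_iff_false, iff_false]
      rintro ⟨hx, h0⟩
      rw [Finset.sum_insert hb₀, Finset.sum_eq_zero (s := T) (fun b hb => by rw [hT b hb, zero_mul]),
        add_zero] at h0
      exact mul_ne_zero hw0 (Real.rpow_pos_of_pos (hx _ (Finset.mem_insert_self _ _)) _).ne' h0

theorem aux_sqrt (T : Finset ℝ) (hT : ∀ b ∈ T, b ≠ 0) (K : ℝ) (w : ℝ → ℝ)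
    (hw : ∃ b ∈ T, w b ≠ 0) :
    {x : ℝ | x ∈ {x : ℝ | ∀ b ∈ T, 0 < 1 / 4 - b * x} ∧
      K + ∑ b ∈ T, w b * Real.sqrt (1 / 4 - b * x) = 0}.Finite := by
  have h := aux_pow T (1 / 2 - 1) (fun k hk => by
    have : (0 : ℝ) ≤ k := Nat.cast_nonneg k
    linarith) (fun b => w b * (-b * (1 / 2))) (by
      obtain ⟨b, hb, hwb⟩ := hw
      exact ⟨b, hb, mul_ne_zero hwb (mul_ne_zero (neg_ne_zero.mpr (hT b hb)) (by norm_num))⟩)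
  have := aux_rolle _ (aux_ordc T) (fun x => K + ∑ b ∈ T, w b * (1 / 4 - b * x) ^ (1 / 2 : ℝ))
    (fun x => ∑ b ∈ T, w b * (-b * (1 / 2)) * (1 / 4 - b * x) ^ ((1 / 2 : ℝ) - 1))
    (fun x hx => by
      refine HasDerivAt.const_add _ (HasDerivAt.fun_sum fun b hb => ?_)
      rw [mul_assoc]
      exact (aux_deriv _ _ _ (hx _ hb)).const_mul _) h
  simpa only [Real.sqrt_eq_rpow] using this

theorem aux_main (v : ℝ) (n : ℕ) (a : Fin n → ℝ) (ha : ∀ j, a j ≠ 0) (u : Fin n → ℝ) (K : ℝ)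
    (hK : ∑ j, u j ≠ 0 ∨ K ≠ 0) :
    {σ : ℝ | (∀ j, u j ≠ 0 → 0 < 1 / 4 - a j / (σ - v)) ∧
      ∑ j, u j * rExp v (a j) σ = K}.Finite := by
  classical
  set S : Finset (Fin n) := Finset.univ.filter (fun j => u j ≠ 0) with hS
  set T : Finset ℝ := S.image a with hTdef
  set w : ℝ → ℝ := fun b => ∑ j ∈ S with a j = b, u j with hw
  have hgroup : ∀ g : ℝ → ℝ, ∑ j, u j * g (a j) = ∑ b ∈ T, w b * g b := by
    intro g
    have h1 : ∑ j, u j * g (a j) = ∑ j ∈ S, u j * g (a j) := by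
      symm
      refine Finset.sum_subset (Finset.subset_univ _) fun j _ hj => ?_
      have : u j = 0 := by simpa [hS] using hj
      rw [this, zero_mul]
    rw [h1, ← Finset.sum_fiberwise_of_maps_to (t := T) (g := a)
      (fun j hj => Finset.mem_image_of_mem a hj)]
    refine Finset.sum_congr rfl fun b _ => ?_
    rw [hw, Finset.sum_mul]
    refine Finset.sum_congr rfl fun j hj => ?_
    rw [(Finset.mem_filter.mp hj).2]
  by_cases hne : ∃ b ∈ T, w b ≠ 0
  · have hfin := aux_sqrt T (by
      intro b hb
      obtain ⟨j, _, rfl⟩ := Finset.mem_image.mp hb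
      exact ha j) (K - (∑ j, u j) * (1 / 2)) w hne
    have hinj : Function.Injective (fun σ : ℝ => (σ - v)⁻¹) := fun s t h => by
      have := inv_injective h
      linarith
    refine (hfin.preimage hinj.injOn).subset ?_
    rintro σ ⟨h1, h2⟩
    refine ⟨?_, ?_⟩
    · intro b hb
      obtain ⟨j, hj, rfl⟩ := Finset.mem_image.mp hb
      have := h1 j (by simpa [hS] using hj)
      rwa [div_eq_mul_inv] at this
    · have h3 := hgroup (fun b => Real.sqrt (1 / 4 - b * (σ - v)⁻¹))
      simp only at h3 ⊢
      rw [← h3, ← h2, Finset.sum_mul, ← Finset.sum_sub_distrib, ← Finset.sum_add_distrib]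
      refine Finset.sum_eq_zero fun j _ => ?_
      rw [rExp, div_eq_mul_inv (a j)]; ring
  · push Not at hne
    convert Set.finite_empty
    ext σ
    simp only [Set.mem_ofPred_eq, Set.mem_empty_iff_false, iff_false]
    rintro ⟨_, h2⟩
    have h3 := hgroup (fun b => rExp v b σ)
    have h4 := hgroup (fun _ => 1)
    rw [Finset.sum_eq_zero (s := T) (fun b hb => by rw [hne b hb, zero_mul])] at h3 h4
    simp only [mul_one] at h4
    rcases hK with hK | hK
    · exact hK h4
    · exact hK (h2.symm.trans h3)

theorem aux_mono (v a s t : ℝ) (ha : a < 0) (hs : v < s) (hst : s ≤ t) :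
    rExp v a s ≤ rExp v a t := by
  unfold rExp
  have : Real.sqrt (1 / 4 - a / (t - v)) ≤ Real.sqrt (1 / 4 - a / (s - v)) := by
    apply Real.sqrt_le_sqrt
    have : -a / (t - v) ≤ -a / (s - v) :=
      div_le_div_of_nonneg_left (by linarith) (by linarith) (by linarith)
    rw [neg_div, neg_div] at this
    linarith
  linarith

theorem aux_neg (v a s : ℝ) (ha : a < 0) (hs : v < s) : rExp v a s < 0 := by
  unfold rExp
  have : (1 / 2 : ℝ) < Real.sqrt (1 / 4 - a / (s - v)) := by
    apply Real.lt_sqrt_of_sq_lt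
    have : a / (s - v) < 0 := div_neg_of_neg_of_pos ha (by linarith)
    norm_num
    linarith
  linarith

theorem aux_unst (v a s d : ℝ) (ha : 0 < 4 * a) (hs : 4 * a < s - v) (hd : s ≤ d) :
    a / (d - v) ≤ rExp v a s ∧ a / (d - v) ≤ 1 - rExp v a s := by
  have h1 : a / (d - v) ≤ a / (s - v) :=
    div_le_div_of_nonneg_left (by linarith) (by linarith) (by linarith)
  have h2 : a / (s - v) < 1 / 4 := by
    rw [div_lt_iff₀ (by linarith)]; linarith
  have h3 : Real.sqrt (1 / 4 - a / (s - v)) ≤ 1 / 2 - a / (s - v) := by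
    rw [Real.sqrt_le_left (by linarith)]
    nlinarith [sq_nonneg (a / (s - v))]
  have h4 := Real.sqrt_nonneg (1 / 4 - a / (s - v))
  unfold rExp
  constructor <;> linarith

theorem aux_nat_bound {ι : Type*} [Finite ι] (f : ι → ℝ) : ∃ N : ℕ, ∀ i, f i ≤ N := by
  obtain ⟨M, hM⟩ := (Set.finite_range f).bddAbove
  obtain ⟨N, hN⟩ := exists_nat_ge M
  exact ⟨N, fun i => (hM ⟨i, rfl⟩).trans hN⟩

/-- **Discreteness of Hessian thresholds and effectively resonant energies.**
Fix `v ∈ ℝ` and nonzero Hessian eigenvalues `a₁, …, aₙ`.  The set of energies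
`σ ∈ (v, ∞)` which are Hessian thresholds (`σ = v + 4aⱼ` with `aⱼ > 0`) or effectively
resonant (in the stable or the unstable-real sense) intersects every compact subinterval
`[c, d] ⊆ (v, ∞)` in a finite set. -/
theorem effectively_resonant_energies_discrete (v : ℝ) (n : ℕ) (a : Fin n → ℝ)
    (ha : ∀ j, a j ≠ 0) :
    ∀ c d : ℝ, v < c →
      ({σ : ℝ | v < σ ∧
        ((∃ j, 0 < a j ∧ σ = v + 4 * a j) ∨
         (∃ k, a k < 0 ∧ ∃ α : Fin n → ℕ,
            (∀ j, α j ≠ 0 → a j < 0) ∧ 2 ≤ ∑ j, α j ∧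
            ∑ j, (α j : ℝ) * rExp v (a j) σ = rExp v (a k) σ) ∨
         (∃ α β : Fin n → ℕ,
            (∀ j, (α j ≠ 0 ∨ β j ≠ 0) → (0 < 4 * a j ∧ 4 * a j < σ - v)) ∧
            3 ≤ ∑ j, (α j + β j) ∧
            ∑ j, ((α j : ℝ) * rExp v (a j) σ + (β j : ℝ) * (1 - rExp v (a j) σ)) = 1))} ∩
        Set.Icc c d).Finite := by
  classical
  intro c d hc
  obtain ⟨N, hN⟩ := aux_nat_bound
    (fun q : Fin n × Fin n => rExp v (a q.2) c / rExp v (a q.1) d)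
  obtain ⟨M, hM⟩ := aux_nat_bound (fun j : Fin n => (d - v) / a j)
  have hA : (Set.range (fun j => v + 4 * a j)).Finite := Set.finite_range _
  have hB : (⋃ k : Fin n, ⋃ α ∈ {α : Fin n → ℕ | α ≤ (fun _ => N) ∧ 2 ≤ ∑ j, α j},
      {σ : ℝ | (∀ j, ((α j : ℝ) - if j = k then 1 else 0) ≠ 0 → 0 < 1 / 4 - a j / (σ - v)) ∧
        ∑ j, ((α j : ℝ) - if j = k then 1 else 0) * rExp v (a j) σ = 0}).Finite := by
    refine Set.finite_iUnion fun k => ?_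
    refine Set.Finite.biUnion ((Set.finite_Iic (fun _ : Fin n => N)).subset fun α h => h.1) ?_
    rintro α ⟨_, hα⟩
    refine aux_main v n a ha _ 0 (Or.inl ?_)
    have : (2 : ℝ) ≤ ∑ j, (α j : ℝ) := by exact_mod_cast hα
    rw [Finset.sum_sub_distrib]
    simp
    linarith
  have hC : (⋃ q ∈ {q : (Fin n → ℕ) × (Fin n → ℕ) |
        (q.1 ≤ (fun _ => M) ∧ q.2 ≤ (fun _ => M)) ∧ 3 ≤ ∑ j, (q.1 j + q.2 j)},
      {σ : ℝ | (∀ j, ((q.1 j : ℝ) - q.2 j) ≠ 0 → 0 < 1 / 4 - a j / (σ - v)) ∧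
        ∑ j, ((q.1 j : ℝ) - q.2 j) * rExp v (a j) σ = 1 - ∑ j, (q.2 j : ℝ)}).Finite := by
    refine Set.Finite.biUnion (((Set.finite_Iic (fun _ : Fin n => M)).prod
      (Set.finite_Iic (fun _ : Fin n => M))).subset fun q h => h.1) ?_
    rintro ⟨α, β⟩ ⟨_, hq⟩
    refine aux_main v n a ha _ _ ?_
    by_contra hcon
    push Not at hcon
    obtain ⟨h1, h2⟩ := hcon
    have h3 : (3 : ℝ) ≤ ∑ j, ((α j : ℝ) + β j) := by exact_mod_cast hq
    simp only at h1 h2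
    rw [Finset.sum_sub_distrib] at h1
    rw [Finset.sum_add_distrib] at h3
    linarith
  refine ((hA.union hB).union hC).subset ?_
  rintro σ ⟨⟨hv, h⟩, hcσ, hσd⟩
  have hpos : 0 < σ - v := by linarith
  rcases h with ⟨j, _, rfl⟩ | ⟨k, hk, α, hα, hα2, hsum⟩ | ⟨α, β, hαβ, h3, hsum⟩
  · exact Or.inl (Or.inl ⟨j, rfl⟩)
  · refine Or.inl (Or.inr ?_)
    simp only [Set.mem_iUnion]
    refine ⟨k, α, ⟨fun j => ?_, hα2⟩, ?_, ?_⟩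
    · by_cases hj : α j = 0
      · rw [hj]; exact Nat.zero_le _
      have haj := hα j hj
      have hle : ∑ i, (α i : ℝ) * rExp v (a i) σ ≤ (α j : ℝ) * rExp v (a j) σ := by
        have := Finset.single_le_sum (f := fun i => -((α i : ℝ) * rExp v (a i) σ))
          (s := Finset.univ) (fun i _ => by
            by_cases hi : α i = 0
            · simp [hi]
            · have := aux_neg v (a i) σ (hα i hi) hv
              have h' : (0 : ℝ) ≤ α i := Nat.cast_nonneg _
              nlinarith) (Finset.mem_univ j)
        simp only [Finset.sum_neg_distrib] at this
        linarith
      have h1 := aux_mono v (a k) c σ hk hc hcσ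
      have h2 := aux_mono v (a j) σ d haj hv hσd
      have h4 := aux_neg v (a j) d haj (by linarith)
      have h5 : (α j : ℝ) ≤ rExp v (a k) c / rExp v (a j) d := by
        rw [le_div_iff_of_neg h4]
        have h' : (0 : ℝ) ≤ α j := Nat.cast_nonneg _
        have := mul_le_mul_of_nonneg_left h2 h'
        linarith
      exact_mod_cast h5.trans (hN (j, k))
    · intro j hj
      have haj : a j < 0 := by
        by_cases hjk : j = k
        · rw [hjk]; exact hk
        · refine hα j fun h0 => hj ?_
          simp [h0, hjk]
      have := div_neg_of_neg_of_pos haj hpos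
      linarith
    · simp only [sub_mul, Finset.sum_sub_distrib, hsum]
      simp
  · refine Or.inr ?_
    simp only [Set.mem_iUnion]
    have hnn : ∀ i, 0 ≤ (α i : ℝ) * rExp v (a i) σ ∧
        0 ≤ (β i : ℝ) * (1 - rExp v (a i) σ) := by
      intro i
      by_cases hi : α i ≠ 0 ∨ β i ≠ 0
      · obtain ⟨h1, h2⟩ := hαβ i hi
        obtain ⟨h5, h6⟩ := aux_unst v (a i) σ d h1 h2 hσd
        have h7 : 0 ≤ a i / (d - v) := div_nonneg (by linarith) (by linarith)
        exact ⟨mul_nonneg (Nat.cast_nonneg _) (h7.trans h5),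
          mul_nonneg (Nat.cast_nonneg _) (h7.trans h6)⟩
      · push Not at hi
        simp [hi.1, hi.2]
    have hb : ∀ i, α i ≤ M ∧ β i ≤ M := by
      intro i
      by_cases hi : α i ≠ 0 ∨ β i ≠ 0
      · obtain ⟨h1, h2⟩ := hαβ i hi
        obtain ⟨h5, h6⟩ := aux_unst v (a i) σ d h1 h2 hσd
        have hdv : 0 < d - v := by linarith
        have hai : 0 < a i := by linarith
        have hle := Finset.single_le_sum
          (f := fun i => (α i : ℝ) * rExp v (a i) σ + (β i : ℝ) * (1 - rExp v (a i) σ))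
          (s := Finset.univ) (fun i _ => add_nonneg (hnn i).1 (hnn i).2) (Finset.mem_univ i)
        rw [hsum] at hle
        have key : ∀ m : ℕ, (m : ℝ) * (a i / (d - v)) ≤ 1 → m ≤ M := by
          intro m hm
          have : (m : ℝ) ≤ (d - v) / a i := by
            rw [le_div_iff₀ hai]
            rw [← mul_div_assoc, div_le_one hdv] at hm
            exact hm
          exact_mod_cast this.trans (hM i)
        constructor
        · apply key
          have := mul_le_mul_of_nonneg_left h5 (Nat.cast_nonneg (α := ℝ) (α i))
          linarith [(hnn i).2]
        · apply key
          have := mul_le_mul_of_nonneg_left h6 (Nat.cast_nonneg (α := ℝ) (β i))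
          linarith [(hnn i).1]
      · push Not at hi
        simp [hi.1, hi.2]
    refine ⟨(α, β), ⟨⟨fun i => (hb i).1, fun i => (hb i).2⟩, h3⟩, ?_, ?_⟩
    · intro j hj
      have hj' : α j ≠ 0 ∨ β j ≠ 0 := by
        by_contra hcon
        push Not at hcon
        exact hj (by simp [hcon.1, hcon.2])
      obtain ⟨h1, h2⟩ := hαβ j hj'
      have : a j / (σ - v) < 1 / 4 := by
        rw [div_lt_iff₀ hpos]; linarith
      linarith
    · rw [← hsum, ← Finset.sum_sub_distrib]
      refine Finset.sum_congr rfl fun j _ => ?_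
      ring
end
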